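/- arXiv:2206.01657 — 3 statements merged into one kernel-verified Lean document; each statement's English description precedes it below -/
import Mathlib

section
/- Suppose C, K, B, and all N_j are analytic at σ_1,…,σ_k, ς_1,…,ς_κ ∈ ℂ and that K and K̂ = Wᴴ K V are invertible at all of these points. Let b ∈ ℂ^m, c ∈ ℂ^p, and nonnegative integers ℓ_1,…,ℓ_k and ν_1,…,ν_κ be given. Let the column space of V contain the columns of the blockwise Hermite matrices V_{i,j_i} built from the points σ_1,…,σ_k, the direction b, and the derivative orders ℓ_1,…,ℓ_k (the derivative analogue of V_1 = K(σ_1)^{-1}B(σ_1)b, V_j = K(σ_j)^{-1}N(σ_{j-1})(I_m ⊗ V_{j-1}), where the i-th level carries derivative orders j_i = 0,…,ℓ_i at σ_i and fixed order ℓ_{i'} at σ_{i'} for i' < i), and let the column space of W contain the columns of W_{1,i} = (∂_{s^i}(cᴴ C K^{-1})(ς_κ))ᴴ (i = 0,…,ν_κ) and W_{i,j} = (∂_{s^j}((I_m ⊗ W_{i-1,ν_{κ-i+2}})ᴴ Ñ K^{-1})(ς_{κ-i+1}))ᴴ (2 ≤ i ≤ κ, j = 0,…,ν_{κ-i+1}).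 Then for all 1 ≤ q ≤ k, 1 ≤ η ≤ κ, j_q = 0,…,ℓ_q, and i = 0,…,ν_{κ-η+1}, it holds that cᴴ ∂_{s_1^{ℓ_1} ⋯ s_{q-1}^{ℓ_{q-1}} s_q^{j_q} s_{q+1}^{i} s_{q+2}^{ν_{κ-η+2}} ⋯ s_{q+η}^{ν_κ}} G_{q+η}(σ_1,…,σ_q, ς_{κ-η+1},…,ς_κ)(I_{m^{q+η-1}} ⊗ b) equals the same expression with G_{q+η} replaced by the reduced-order Ĝ_{q+η}. -/
open Matrix
open scoped Kronecker

namespace StructBilin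

/-- Scaled sum of the bilinear terms: `𝔑(s, d) = ∑ i, d i • N i s`. -/
noncomputable def Nsum {n m : ℕ} (N : Fin m → ℂ → Matrix (Fin n) (Fin n) ℂ) (s : ℂ)
    (d : Fin m → ℂ) : Matrix (Fin n) (Fin n) ℂ :=
  ∑ i, d i • N i s

/-- Middle factor of the modified transfer function
`𝔾_{q+1}(σ 0, …, σ q | d 0, …, d (q-1)) = C (σ q) * gAux K B N σ d q`. -/
noncomputable def gAux {n m : ℕ} (K : ℂ → Matrix (Fin n) (Fin n) ℂ)
    (B : ℂ → Matrix (Fin n) (Fin m) ℂ) (N : Fin m → ℂ → Matrix (Fin n) (Fin n) ℂ)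
    (σ : ℕ → ℂ) (d : ℕ → Fin m → ℂ) : ℕ → Matrix (Fin n) (Fin m) ℂ
  | 0 => (K (σ 0))⁻¹ * B (σ 0)
  | j + 1 => (K (σ (j + 1)))⁻¹ * Nsum N (σ j) (d j) * gAux K B N σ d j

/-- The modified (scaled and summed) transfer function
`𝔾_{q+1}(σ 0, …, σ q | d 0, …, d (q-1))` (the level is `q + 1`, indices are 0-based). -/
noncomputable def Gmod {n m p : ℕ} (C : ℂ → Matrix (Fin p) (Fin n) ℂ)
    (K : ℂ → Matrix (Fin n) (Fin n) ℂ) (B : ℂ → Matrix (Fin n) (Fin m) ℂ)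
    (N : Fin m → ℂ → Matrix (Fin n) (Fin n) ℂ) (σ : ℕ → ℂ) (d : ℕ → Fin m → ℂ)
    (q : ℕ) : Matrix (Fin p) (Fin m) ℂ :=
  C (σ q) * gAux K B N σ d q

/-- Right tangential interpolation vectors:
`v 0 = K(σ 0)⁻¹ B(σ 0) b`, `v (j+1) = K(σ (j+1))⁻¹ 𝔑(σ j, d j) v j`. -/
noncomputable def vtan {n m : ℕ} (K : ℂ → Matrix (Fin n) (Fin n) ℂ)
    (B : ℂ → Matrix (Fin n) (Fin m) ℂ) (N : Fin m → ℂ → Matrix (Fin n) (Fin n) ℂ)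
    (σ : ℕ → ℂ) (d : ℕ → Fin m → ℂ) (b : Fin m → ℂ) : ℕ → Fin n → ℂ
  | 0 => (K (σ 0))⁻¹ *ᵥ (B (σ 0) *ᵥ b)
  | j + 1 => (K (σ (j + 1)))⁻¹ *ᵥ (Nsum N (σ j) (d j) *ᵥ vtan K B N σ d b j)

/-- Left tangential interpolation vectors (with reversed point sequence `τ` and
scaling sequence `e`):
`w 0 = K(τ 0)^{-ᴴ} C(τ 0)ᴴ c`, `w (t+1) = K(τ (t+1))^{-ᴴ} 𝔑(τ (t+1), e t)ᴴ w t`. -/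
noncomputable def wtan {n m p : ℕ} (C : ℂ → Matrix (Fin p) (Fin n) ℂ)
    (K : ℂ → Matrix (Fin n) (Fin n) ℂ) (N : Fin m → ℂ → Matrix (Fin n) (Fin n) ℂ)
    (τ : ℕ → ℂ) (e : ℕ → Fin m → ℂ) (c : Fin p → ℂ) : ℕ → Fin n → ℂ
  | 0 => ((K (τ 0))⁻¹)ᴴ *ᵥ ((C (τ 0))ᴴ *ᵥ c)
  | t + 1 => ((K (τ (t + 1)))⁻¹)ᴴ *ᵥ ((Nsum N (τ (t + 1)) (e t))ᴴ *ᵥ wtan C K N τ e c t)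

/-- Entrywise `t`-th complex derivative of a matrix-valued function. -/
noncomputable def mDeriv {α β : Type*} (t : ℕ) (f : ℂ → Matrix α β ℂ) (z : ℂ) :
    Matrix α β ℂ :=
  Matrix.of fun i j => iteratedDeriv t (fun w => f w i j) z

/-- Entrywise `t`-th complex derivative of a vector-valued function. -/
noncomputable def vDeriv {α : Type*} (t : ℕ) (f : ℂ → α → ℂ) (z : ℂ) : α → ℂ :=
  fun i => iteratedDeriv t (fun w => f w i) z

/-- Partial derivative in the `i`-th coordinate of a function of countably many
complex variables. -/
noncomputable def pD (i : ℕ) (f : (ℕ → ℂ) → ℂ) (s : ℕ → ℂ) : ℂ :=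
  deriv (fun z => f (Function.update s i z)) (s i)

/-- Mixed partial derivative `∂_{s_1^{ord 0} ⋯ s_t^{ord (t-1)}}` of a function of the
first `t` coordinates. -/
noncomputable def mixedD (ord : ℕ → ℕ) : ℕ → ((ℕ → ℂ) → ℂ) → (ℕ → ℂ) → ℂ
  | 0, f => f
  | t + 1, f => mixedD ord t ((pD t)^[ord t] f)

/-- The Hermite chain
`hChain t = ∂^{ℓ (t)}(𝔑(·, d t) K⁻¹)(σ t) ⋯ ∂^{ℓ 0}(𝔑(·, d 0) K⁻¹ B)(σ 0)`. -/
noncomputable def hChain {n m : ℕ} (K : ℂ → Matrix (Fin n) (Fin n) ℂ)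
    (B : ℂ → Matrix (Fin n) (Fin m) ℂ) (N : Fin m → ℂ → Matrix (Fin n) (Fin n) ℂ)
    (σ : ℕ → ℂ) (d : ℕ → Fin m → ℂ) (ℓ : ℕ → ℕ) : ℕ → Matrix (Fin n) (Fin m) ℂ
  | 0 => mDeriv (ℓ 0) (fun z => Nsum N z (d 0) * ((K z)⁻¹ * B z)) (σ 0)
  | t + 1 =>
      mDeriv (ℓ (t + 1)) (fun z => Nsum N z (d (t + 1)) * (K z)⁻¹) (σ (t + 1)) *
        hChain K B N σ d ℓ t

/-- Right tangential Hermite interpolation vectors. -/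
noncomputable def vHerm {n m : ℕ} (K : ℂ → Matrix (Fin n) (Fin n) ℂ)
    (B : ℂ → Matrix (Fin n) (Fin m) ℂ) (N : Fin m → ℂ → Matrix (Fin n) (Fin n) ℂ)
    (σ : ℕ → ℂ) (d : ℕ → Fin m → ℂ) (ℓ : ℕ → ℕ) (b : Fin m → ℂ) : ℕ → ℕ → Fin n → ℂ
  | 0, j => mDeriv j (fun z => (K z)⁻¹ * B z) (σ 0) *ᵥ b
  | t + 1, j => (mDeriv j (fun z => (K z)⁻¹) (σ (t + 1)) * hChain K B N σ d ℓ t) *ᵥ b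

/-- Left tangential Hermite interpolation vectors (with reversed sequences). -/
noncomputable def wHerm {n m p : ℕ} (C : ℂ → Matrix (Fin p) (Fin n) ℂ)
    (K : ℂ → Matrix (Fin n) (Fin n) ℂ) (N : Fin m → ℂ → Matrix (Fin n) (Fin n) ℂ)
    (τ : ℕ → ℂ) (e : ℕ → Fin m → ℂ) (eν : ℕ → ℕ) (c : Fin p → ℂ) : ℕ → ℕ → Fin n → ℂ
  | 0, i => star (vDeriv i (fun z => Matrix.vecMul (star c) (C z * (K z)⁻¹)) (τ 0))
  | t + 1, j =>
      star (vDeriv j (fun z =>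
        Matrix.vecMul (star (wHerm C K N τ e eν c t (eν t))) (Nsum N z (e t) * (K z)⁻¹))
        (τ (t + 1)))

/-- Column index type of the `j+1`-st subsystem transfer function (`m^(j+1)` indices). -/
def colT (m : ℕ) : ℕ → Type
  | 0 => Fin m
  | j + 1 => Fin m × colT m j

def colTFintype (m : ℕ) : ∀ j, Fintype (colT m j)
  | 0 => inferInstanceAs (Fintype (Fin m))
  | j + 1 => letI := colTFintype m j; inferInstanceAs (Fintype (Fin m × colT m j))

attribute [instance] colTFintype

/-- Block index type (`m^j` indices). -/
def outT (m : ℕ) : ℕ → Type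
  | 0 => Fin 1
  | j + 1 => Fin m × outT m j

def outTFintype (m : ℕ) : ∀ j, Fintype (outT m j)
  | 0 => inferInstanceAs (Fintype (Fin 1))
  | j + 1 => letI := outTFintype m j; inferInstanceAs (Fintype (Fin m × outT m j))

attribute [instance] outTFintype

/-- The horizontal concatenation `N(s) = [N_1(s) ⋯ N_m(s)]`. -/
noncomputable def Nbig {n m : ℕ} (N : Fin m → ℂ → Matrix (Fin n) (Fin n) ℂ) (s : ℂ) :
    Matrix (Fin n) (Fin m × Fin n) ℂ :=
  Matrix.of fun i q => N q.1 s i q.2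

/-- The vertical concatenation `Ñ(s)` of `N_1(s), …, N_m(s)`. -/
noncomputable def Ntil {n m : ℕ} (N : Fin m → ℂ → Matrix (Fin n) (Fin n) ℂ) (s : ℂ) :
    Matrix (Fin m × Fin n) (Fin n) ℂ :=
  Matrix.of fun q i => N q.1 s q.2 i

/-- State part of the `j+1`-st subsystem transfer function:
`Z 0 = K(σ 0)⁻¹ B(σ 0)`, `Z (j+1) = K(σ (j+1))⁻¹ N(σ j) (I_m ⊗ Z j)`. -/
noncomputable def Zblk {n m : ℕ} (K : ℂ → Matrix (Fin n) (Fin n) ℂ)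
    (B : ℂ → Matrix (Fin n) (Fin m) ℂ) (N : Fin m → ℂ → Matrix (Fin n) (Fin n) ℂ)
    (σ : ℕ → ℂ) : (j : ℕ) → Matrix (Fin n) (colT m j) ℂ
  | 0 => (K (σ 0))⁻¹ * B (σ 0)
  | j + 1 =>
      (K (σ (j + 1)))⁻¹ * Nbig N (σ j) *
        ((1 : Matrix (Fin m) (Fin m) ℂ) ⊗ₖ Zblk K B N σ j)

/-- The `q+1`-st subsystem transfer function `G_{q+1}(σ 0, …, σ q)`. -/
noncomputable def Gblk {n m p : ℕ} (C : ℂ → Matrix (Fin p) (Fin n) ℂ)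
    (K : ℂ → Matrix (Fin n) (Fin n) ℂ) (B : ℂ → Matrix (Fin n) (Fin m) ℂ)
    (N : Fin m → ℂ → Matrix (Fin n) (Fin n) ℂ) (σ : ℕ → ℂ) (q : ℕ) :
    Matrix (Fin p) (colT m q) ℂ :=
  C (σ q) * Zblk K B N σ q

/-- The tangential direction matrix `I_{m^j} ⊗ b`. -/
noncomputable def tangMat {m : ℕ} (b : Fin m → ℂ) :
    (j : ℕ) → Matrix (colT m j) (outT m j) ℂ
  | 0 => Matrix.of fun i _ => b i
  | j + 1 => (1 : Matrix (Fin m) (Fin m) ℂ) ⊗ₖ tangMat b j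

/-- Blockwise right interpolation matrices:
`V 0 = K(σ 0)⁻¹ B(σ 0) b`, `V (j+1) = K(σ (j+1))⁻¹ N(σ j) (I_m ⊗ V j)`. -/
noncomputable def Vblk {n m : ℕ} (K : ℂ → Matrix (Fin n) (Fin n) ℂ)
    (B : ℂ → Matrix (Fin n) (Fin m) ℂ) (N : Fin m → ℂ → Matrix (Fin n) (Fin n) ℂ)
    (σ : ℕ → ℂ) (b : Fin m → ℂ) : (j : ℕ) → Matrix (Fin n) (outT m j) ℂ
  | 0 => Matrix.of fun i _ => ((K (σ 0))⁻¹ *ᵥ (B (σ 0) *ᵥ b)) i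
  | j + 1 =>
      (K (σ (j + 1)))⁻¹ * Nbig N (σ j) *
        ((1 : Matrix (Fin m) (Fin m) ℂ) ⊗ₖ Vblk K B N σ b j)

/-- Blockwise left interpolation matrices (with reversed point sequence `τ`):
`W 0 = K(τ 0)^{-ᴴ} C(τ 0)ᴴ c`, `W (t+1) = K(τ (t+1))^{-ᴴ} Ñ(τ (t+1))ᴴ (I_m ⊗ W t)`. -/
noncomputable def Wblk {n m p : ℕ} (C : ℂ → Matrix (Fin p) (Fin n) ℂ)
    (K : ℂ → Matrix (Fin n) (Fin n) ℂ) (N : Fin m → ℂ → Matrix (Fin n) (Fin n) ℂ)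
    (τ : ℕ → ℂ) (c : Fin p → ℂ) : (t : ℕ) → Matrix (Fin n) (outT m t) ℂ
  | 0 => Matrix.of fun i _ => (((K (τ 0))⁻¹)ᴴ *ᵥ ((C (τ 0))ᴴ *ᵥ c)) i
  | t + 1 =>
      ((K (τ (t + 1)))⁻¹)ᴴ * (Ntil N (τ (t + 1)))ᴴ *
        ((1 : Matrix (Fin m) (Fin m) ℂ) ⊗ₖ Wblk C K N τ c t)

/-- A vector as a one-column matrix. -/
noncomputable def bCol {m : ℕ} (b : Fin m → ℂ) : Matrix (Fin m) (Fin 1) ℂ :=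
  Matrix.of fun i _ => b i

/-- Blockwise Hermite chain. -/
noncomputable def hChainB {n m : ℕ} (K : ℂ → Matrix (Fin n) (Fin n) ℂ)
    (B : ℂ → Matrix (Fin n) (Fin m) ℂ) (N : Fin m → ℂ → Matrix (Fin n) (Fin n) ℂ)
    (σ : ℕ → ℂ) (ℓ : ℕ → ℕ) (b : Fin m → ℂ) :
    (t : ℕ) → Matrix (Fin n) (outT m (t + 1)) ℂ
  | 0 => mDeriv (ℓ 0)
      (fun z => Nbig N z * ((1 : Matrix (Fin m) (Fin m) ℂ) ⊗ₖ ((K z)⁻¹ * B z * bCol b)))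
      (σ 0)
  | t + 1 =>
      mDeriv (ℓ (t + 1))
        (fun z => Nbig N z * ((1 : Matrix (Fin m) (Fin m) ℂ) ⊗ₖ (K z)⁻¹)) (σ (t + 1)) *
        ((1 : Matrix (Fin m) (Fin m) ℂ) ⊗ₖ hChainB K B N σ ℓ b t)

/-- Blockwise right Hermite interpolation matrices. -/
noncomputable def vHermB {n m : ℕ} (K : ℂ → Matrix (Fin n) (Fin n) ℂ)
    (B : ℂ → Matrix (Fin n) (Fin m) ℂ) (N : Fin m → ℂ → Matrix (Fin n) (Fin n) ℂ)
    (σ : ℕ → ℂ) (ℓ : ℕ → ℕ) (b : Fin m → ℂ) : (t : ℕ) → ℕ → Matrix (Fin n) (outT m t) ℂ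
  | 0, j => mDeriv j (fun z => (K z)⁻¹ * B z * bCol b) (σ 0)
  | t + 1, j => mDeriv j (fun z => (K z)⁻¹) (σ (t + 1)) * hChainB K B N σ ℓ b t

/-- Blockwise left Hermite interpolation matrices (with reversed sequences). -/
noncomputable def wHermB {n m p : ℕ} (C : ℂ → Matrix (Fin p) (Fin n) ℂ)
    (K : ℂ → Matrix (Fin n) (Fin n) ℂ) (N : Fin m → ℂ → Matrix (Fin n) (Fin n) ℂ)
    (τ : ℕ → ℂ) (eν : ℕ → ℕ) (c : Fin p → ℂ) : (t : ℕ) → ℕ → Matrix (Fin n) (outT m t) ℂ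
  | 0, i => Matrix.of fun idx _ =>
      star (iteratedDeriv i (fun z => Matrix.vecMul (star c) (C z * (K z)⁻¹) idx) (τ 0))
  | t + 1, j => Matrix.of fun idx cc =>
      star (iteratedDeriv j (fun z =>
        (((1 : Matrix (Fin m) (Fin m) ℂ) ⊗ₖ wHermB C K N τ eν c t (eν t))ᴴ * Ntil N z *
          (K z)⁻¹) cc idx) (τ (t + 1)))

/-- The Kronecker product `d (j-1) ⊗ ⋯ ⊗ d 0 ⊗ I_m` of scaling vectors with the identity. -/
noncomputable def dKron {m : ℕ} (d : ℕ → Fin m → ℂ) :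
    (j : ℕ) → Matrix (colT m j) (Fin m) ℂ
  | 0 => (1 : Matrix (Fin m) (Fin m) ℂ)
  | j + 1 => Matrix.of fun (pq : Fin m × colT m j) cix => d j pq.1 * dKron d j pq.2 cix

/-- The innermost (input) coordinate of a column multi-index. -/
def innerIdx (m : ℕ) : (j : ℕ) → colT m j → Fin m
  | 0 => fun x => x
  | j + 1 => fun (pq : Fin m × colT m j) => innerIdx m j pq.2

/-- The chain `K(σ t)⁻¹ N_{J (t-1)}(σ (t-1)) ⋯ N_{J 0}(σ 0) K(σ 0)⁻¹ B(σ 0)`. -/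
noncomputable def eChain {n m : ℕ} (K : ℂ → Matrix (Fin n) (Fin n) ℂ)
    (B : ℂ → Matrix (Fin n) (Fin m) ℂ) (N : Fin m → ℂ → Matrix (Fin n) (Fin n) ℂ)
    (σ : ℕ → ℂ) (J : ℕ → Fin m) : ℕ → Matrix (Fin n) (Fin m) ℂ
  | 0 => (K (σ 0))⁻¹ * B (σ 0)
  | t + 1 => (K (σ (t + 1)))⁻¹ * N (J t) (σ t) * eChain K B N σ J t

section MatrixDerivatives

variable {α β γ δ : Type*}

/-- Entrywise analyticity of a matrix-valued function at a point. -/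
def MatAnalyticAt (f : ℂ → Matrix α β ℂ) (z : ℂ) : Prop :=
  ∀ i j, AnalyticAt ℂ (fun w => f w i j) z

theorem MatAnalyticAt.const (A : Matrix α β ℂ) (z : ℂ) : MatAnalyticAt (fun _ => A) z :=
  fun _ _ => analyticAt_const

theorem MatAnalyticAt.mul [Fintype β] {f : ℂ → Matrix α β ℂ} {g : ℂ → Matrix β γ ℂ} {z : ℂ}
    (hf : MatAnalyticAt f z) (hg : MatAnalyticAt g z) :
    MatAnalyticAt (fun w => f w * g w) z := by
  intro i j
  simp only [Matrix.mul_apply]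
  exact Finset.analyticAt_fun_sum _ fun x _ => (hf i x).mul (hg x j)

theorem MatAnalyticAt.transpose {f : ℂ → Matrix α β ℂ} {z : ℂ} (hf : MatAnalyticAt f z) :
    MatAnalyticAt (fun w => (f w)ᵀ) z :=
  fun i j => hf j i

theorem MatAnalyticAt.det [Fintype α] [DecidableEq α] {f : ℂ → Matrix α α ℂ} {z : ℂ}
    (hf : MatAnalyticAt f z) : AnalyticAt ℂ (fun w => (f w).det) z := by
  simp only [Matrix.det_apply']
  exact Finset.analyticAt_fun_sum _ fun σ _ => analyticAt_const.mul
    (Finset.analyticAt_fun_prod _ fun i _ => hf (σ i) i)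

theorem MatAnalyticAt.inv [Fintype α] [DecidableEq α] {f : ℂ → Matrix α α ℂ} {z : ℂ}
    (hf : MatAnalyticAt f z) (h : IsUnit (f z).det) : MatAnalyticAt (fun w => (f w)⁻¹) z := by
  intro i j
  simp only [Matrix.inv_def, Matrix.smul_apply, smul_eq_mul, Ring.inverse_eq_inv',
    Matrix.adjugate_apply]
  refine (hf.det.inv h.ne_zero).mul (MatAnalyticAt.det fun a e => ?_)
  by_cases ha : a = j
  · subst ha
    simpa using analyticAt_const
  · simpa [Matrix.updateRow_ne ha] using hf a e

theorem MatAnalyticAt.eventually_isUnit_det [Fintype α] [DecidableEq α]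
    {f : ℂ → Matrix α α ℂ} {z : ℂ} (hf : MatAnalyticAt f z) (h : IsUnit (f z).det) :
    ∀ᶠ w in nhds z, IsUnit (f w).det := by
  filter_upwards [hf.det.continuousAt.eventually_ne h.ne_zero] with w hw using hw.isUnit

theorem mDeriv_congr {f g : ℂ → Matrix α β ℂ} {z : ℂ} (h : f =ᶠ[nhds z] g) (j : ℕ) :
    mDeriv j f z = mDeriv j g z := by
  ext a e
  exact Filter.EventuallyEq.iteratedDeriv_eq j (h.mono fun w hw => by simp only [hw])

theorem mDeriv_zero (f : ℂ → Matrix α β ℂ) (z : ℂ) : mDeriv 0 f z = f z := by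
  ext a e
  simp [mDeriv]

theorem mDeriv_const_mul [Fintype β] (A : Matrix α β ℂ) {f : ℂ → Matrix β γ ℂ} {z : ℂ}
    (hf : MatAnalyticAt f z) (j : ℕ) :
    mDeriv j (fun w => A * f w) z = A * mDeriv j f z := by
  ext a e
  simp only [mDeriv, Matrix.of_apply, Matrix.mul_apply]
  rw [iteratedDeriv_fun_sum fun x _ => contDiffAt_const.mul (hf x e).contDiffAt]
  exact Finset.sum_congr rfl fun x _ => iteratedDeriv_const_mul_field _ _

theorem mDeriv_mul_const [Fintype β] {f : ℂ → Matrix α β ℂ} (A : Matrix β γ ℂ) {z : ℂ}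
    (hf : MatAnalyticAt f z) (j : ℕ) :
    mDeriv j (fun w => f w * A) z = mDeriv j f z * A := by
  have h := congrArg Matrix.transpose (mDeriv_const_mul Aᵀ hf.transpose j)
  simp only [← Matrix.transpose_mul] at h
  rw [Matrix.transpose_mul, Matrix.transpose_transpose] at h
  exact h

/-- Leibniz rule for products of matrix-valued functions. -/
theorem mDeriv_mul [Fintype β] {f : ℂ → Matrix α β ℂ} {g : ℂ → Matrix β γ ℂ} {z : ℂ}
    (hf : MatAnalyticAt f z) (hg : MatAnalyticAt g z) (j : ℕ) :
    mDeriv j (fun w => f w * g w) z =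
      ∑ i ∈ Finset.range (j + 1), (j.choose i : ℂ) • (mDeriv i f z * mDeriv (j - i) g z) := by
  ext a e
  simp only [mDeriv, Matrix.of_apply, Matrix.mul_apply, Matrix.sum_apply, Matrix.smul_apply,
    smul_eq_mul, Finset.mul_sum]
  rw [iteratedDeriv_fun_sum fun x _ => (hf a x).contDiffAt.mul (hg x e).contDiffAt,
    Finset.sum_comm]
  refine Finset.sum_congr rfl fun x _ => ?_
  rw [iteratedDeriv_fun_mul (hf a x).contDiffAt (hg x e).contDiffAt]
  exact Finset.sum_congr rfl fun i _ => mul_assoc _ _ _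

theorem mDeriv_mul_congr_right [Fintype β] {f : ℂ → Matrix α β ℂ} {g g' : ℂ → Matrix β γ ℂ}
    {z : ℂ} (hf : MatAnalyticAt f z) (hg : MatAnalyticAt g z) (hg' : MatAnalyticAt g' z) {l : ℕ}
    (h : ∀ j ≤ l, mDeriv j g z = mDeriv j g' z) :
    mDeriv l (fun w => f w * g w) z = mDeriv l (fun w => f w * g' w) z := by
  rw [mDeriv_mul hf hg, mDeriv_mul hf hg']
  exact Finset.sum_congr rfl fun i _ => by rw [h _ (Nat.sub_le _ _)]

theorem exists_eq_mul_of_col_mem_range [Fintype β] {A : Matrix α β ℂ} {M : Matrix α γ ℂ}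
    (h : ∀ e, (fun i => M i e) ∈ Set.range A.mulVec) : ∃ D : Matrix β γ ℂ, M = A * D := by
  choose d hd using h
  exact ⟨Matrix.of fun i e => d e i, Matrix.ext fun i e => (congrFun (hd e) i).symm⟩

variable [Fintype α] [DecidableEq α] [Fintype δ] [DecidableEq δ]

/-- Petrov-Galerkin projection preserves the derivatives of `K⁻¹ y` lying in the range
of `V`. -/
theorem projection_right {K : ℂ → Matrix α α ℂ} {y : ℂ → Matrix α β ℂ} {z : ℂ}
    (V : Matrix α δ ℂ) (W : Matrix δ α ℂ) (hKa : MatAnalyticAt K z) (hya : MatAnalyticAt y z)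
    (hK : IsUnit (K z).det) (hKr : IsUnit (W * K z * V).det) {l : ℕ}
    (h : ∀ j ≤ l, ∃ D : Matrix δ β ℂ, mDeriv j (fun w => (K w)⁻¹ * y w) z = V * D) :
    ∀ j ≤ l, V * mDeriv j (fun w => (W * K w * V)⁻¹ * (W * y w)) z =
      mDeriv j (fun w => (K w)⁻¹ * y w) z := by
  have hWKa : MatAnalyticAt (fun w => W * K w) z := (MatAnalyticAt.const W z).mul hKa
  have hKra : MatAnalyticAt (fun w => W * K w * V) z := hWKa.mul (MatAnalyticAt.const V z)
  have hva := (hKa.inv hK).mul hya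
  have hvra := (hKra.inv hKr).mul ((MatAnalyticAt.const W z).mul hya)
  intro j
  induction j using Nat.strong_induction_on with
  | _ j ih =>
  intro hj
  obtain ⟨D, hD⟩ := h j hj
  have e1 : mDeriv j (fun w => W * K w * ((K w)⁻¹ * y w)) z = mDeriv j (fun w => W * y w) z := by
    refine mDeriv_congr ?_ j
    filter_upwards [hKa.eventually_isUnit_det hK] with w hw
    rw [Matrix.mul_assoc, Matrix.mul_nonsing_inv_cancel_left _ _ hw]
  have e2 : mDeriv j (fun w => W * K w * V * ((W * K w * V)⁻¹ * (W * y w))) z =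
      mDeriv j (fun w => W * y w) z := by
    refine mDeriv_congr ?_ j
    filter_upwards [hKra.eventually_isUnit_det hKr] with w hw
    rw [Matrix.mul_nonsing_inv_cancel_left _ _ hw]
  have e3 := e2.trans e1.symm
  rw [mDeriv_mul hWKa hva, mDeriv_mul hKra hvra, Finset.sum_range_succ',
    Finset.sum_range_succ'] at e3
  have e4 : ∀ i ∈ Finset.range j,
      (j.choose (i + 1) : ℂ) • (mDeriv (i + 1) (fun w => W * K w * V) z *
        mDeriv (j - (i + 1)) (fun w => (W * K w * V)⁻¹ * (W * y w)) z) =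
      (j.choose (i + 1) : ℂ) • (mDeriv (i + 1) (fun w => W * K w) z *
        mDeriv (j - (i + 1)) (fun w => (K w)⁻¹ * y w) z) := by
    intro i hi
    have hi' := Finset.mem_range.1 hi
    rw [mDeriv_mul_const V hWKa, Matrix.mul_assoc, ih (j - (i + 1)) (by omega) (by omega)]
  rw [Finset.sum_congr rfl e4, add_left_cancel_iff] at e3
  simp only [Nat.choose_zero_right, Nat.cast_one, one_smul, mDeriv_zero, Nat.sub_zero] at e3
  rw [hD, ← Matrix.mul_assoc (W * K z)] at e3
  have e5 := congrArg (fun M => (W * K z * V)⁻¹ * M) e3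
  simp only [Matrix.nonsing_inv_mul_cancel_left _ _ hKr] at e5
  rw [hD, e5]

/-- Petrov-Galerkin projection preserves the derivatives of `x K⁻¹` lying in the row space
of `W`. -/
theorem projection_left {K : ℂ → Matrix α α ℂ} {x : ℂ → Matrix β α ℂ} {z : ℂ}
    (V : Matrix α δ ℂ) (W : Matrix δ α ℂ) (hKa : MatAnalyticAt K z) (hxa : MatAnalyticAt x z)
    (hK : IsUnit (K z).det) (hKr : IsUnit (W * K z * V).det) {l : ℕ}
    (h : ∀ j ≤ l, ∃ D : Matrix β δ ℂ, mDeriv j (fun w => x w * (K w)⁻¹) z = D * W) :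
    ∀ j ≤ l, mDeriv j (fun w => x w * V * (W * K w * V)⁻¹) z * W =
      mDeriv j (fun w => x w * (K w)⁻¹) z := by
  have hT : ∀ w, Vᵀ * (K w)ᵀ * Wᵀ = (W * K w * V)ᵀ := fun w => by
    rw [Matrix.transpose_mul, Matrix.transpose_mul, Matrix.mul_assoc]
  have hv : ∀ w, ((K w)ᵀ)⁻¹ * (x w)ᵀ = (x w * (K w)⁻¹)ᵀ := fun w => by
    rw [Matrix.transpose_mul, Matrix.transpose_nonsing_inv]
  have hvr : ∀ w, (Vᵀ * (K w)ᵀ * Wᵀ)⁻¹ * (Vᵀ * (x w)ᵀ) = (x w * V * (W * K w * V)⁻¹)ᵀ :=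
    fun w => by
      rw [hT, Matrix.transpose_mul (x w * V), Matrix.transpose_nonsing_inv,
        Matrix.transpose_mul (x w)]
  have key := projection_right (l := l) Wᵀ Vᵀ hKa.transpose hxa.transpose
    (by rwa [Matrix.det_transpose]) (by rwa [hT, Matrix.det_transpose])
    (fun j hj => by
      obtain ⟨D, hD⟩ := h j hj
      refine ⟨Dᵀ, ?_⟩
      rw [← Matrix.transpose_mul, ← hD]
      simp only [hv]
      rfl)
  intro j hj
  have h2 := congrArg Matrix.transpose (key j hj)
  simp only [hv, hvr] at h2
  rw [Matrix.transpose_mul, Matrix.transpose_transpose] at h2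
  exact h2

end MatrixDerivatives

section MixedDerivatives

theorem iterate_pD (t j : ℕ) (f : (ℕ → ℂ) → ℂ) (s : ℕ → ℂ) :
    (pD t)^[j] f s = iteratedDeriv j (fun z => f (Function.update s t z)) (s t) := by
  induction j generalizing s with
  | zero => simp
  | succ j ih =>
    rw [Function.iterate_succ_apply', iteratedDeriv_succ, pD]
    simp only [ih, Function.update_self, Function.update_idem]

theorem mixedD_congr (ord : ℕ → ℕ) (t : ℕ) {f g : (ℕ → ℂ) → ℂ} {s : ℕ → ℂ}
    (h : ∀ s' : ℕ → ℂ, (∀ i, t ≤ i → s' i = s i) → f s' = g s') :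
    mixedD ord t f s = mixedD ord t g s := by
  induction t generalizing f g with
  | zero => exact h s fun _ _ => rfl
  | succ t ih =>
    refine ih fun s' hs' => ?_
    rw [iterate_pD, iterate_pD]
    congr 1
    funext z
    refine h _ fun i hi => ?_
    rw [Function.update_of_ne (by omega), hs' i (by omega)]

end MixedDerivatives

section Chains

variable {n m : ℕ}

/-- Prepend an outer index to a column multi-index. -/
def colCons {j : ℕ} (J : Fin m) (e : colT m j) : colT m (j + 1) := (J, e)

/-- Prepend an outer index to a block multi-index. -/
def outCons {j : ℕ} (J : Fin m) (e : outT m j) : outT m (j + 1) := (J, e)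

theorem exists_outCons {j : ℕ} (e : outT m (j + 1)) : ∃ J e', outCons J e' = e :=
  ⟨e.1, e.2, rfl⟩

theorem sum_colT_succ (j : ℕ) (f : colT m (j + 1) → ℂ) :
    ∑ x, f x = ∑ J : Fin m, ∑ x : colT m j, f (colCons J x) :=
  Fintype.sum_prod_type (f := f)

theorem Nbig_mul_kronecker_apply {β : Type*} (N : Fin m → ℂ → Matrix (Fin n) (Fin n) ℂ) (z : ℂ)
    (Z : Matrix (Fin n) β ℂ) (i : Fin n) (J : Fin m) (e : β) :
    (Nbig N z * ((1 : Matrix (Fin m) (Fin m) ℂ) ⊗ₖ Z)) i (J, e) = (N J z * Z) i e := by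
  simp [Matrix.mul_apply, Fintype.sum_prod_type, Matrix.one_apply, Nbig]

variable (K : ℂ → Matrix (Fin n) (Fin n) ℂ) (B : ℂ → Matrix (Fin n) (Fin m) ℂ)
  (N : Fin m → ℂ → Matrix (Fin n) (Fin n) ℂ)

theorem Zblk_succ_apply (s : ℕ → ℂ) (t : ℕ) (i : Fin n) (J : Fin m) (e : colT m t) :
    Zblk K B N s (t + 1) i (colCons J e) =
      ((K (s (t + 1)))⁻¹ * (N J (s t) * Zblk K B N s t)) i e := by
  change ((K (s (t + 1)))⁻¹ * Nbig N (s t) *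
    ((1 : Matrix (Fin m) (Fin m) ℂ) ⊗ₖ Zblk K B N s t)) i (J, e) = _
  rw [Matrix.mul_assoc, Matrix.mul_apply, Matrix.mul_apply]
  exact Finset.sum_congr rfl fun x _ => by rw [Nbig_mul_kronecker_apply]

theorem Zblk_congr {s s' : ℕ → ℂ} (t : ℕ) (h : ∀ i ≤ t, s i = s' i) :
    Zblk K B N s t = Zblk K B N s' t := by
  induction t with
  | zero =>
    change (K (s 0))⁻¹ * B (s 0) = (K (s' 0))⁻¹ * B (s' 0)
    rw [h 0 le_rfl]
  | succ t ih =>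
    change (K (s (t + 1)))⁻¹ * Nbig N (s t) *
        ((1 : Matrix (Fin m) (Fin m) ℂ) ⊗ₖ Zblk K B N s t) =
      (K (s' (t + 1)))⁻¹ * Nbig N (s' t) *
        ((1 : Matrix (Fin m) (Fin m) ℂ) ⊗ₖ Zblk K B N s' t)
    rw [h (t + 1) le_rfl, h t t.le_succ, ih fun i hi => h i (hi.trans t.le_succ)]

/-- Right-hand side of the linear systems with matrix `K` defining the blockwise Hermite
matrices: `B b` at level `0`, and the constant derivative `∂^{ord t}(N_J K⁻¹ y_t)(s t)` in the
block column `J` at level `t + 1`. -/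
noncomputable def rhsChain (s : ℕ → ℂ) (ord : ℕ → ℕ) (b : Fin m → ℂ) :
    (t : ℕ) → ℂ → Matrix (Fin n) (outT m t) ℂ
  | 0 => fun z => B z * bCol b
  | t + 1 => fun _ => Matrix.of fun i (je : Fin m × outT m t) =>
      mDeriv (ord t) (fun z => N je.1 z * ((K z)⁻¹ * rhsChain s ord b t z)) (s t) i je.2

variable {K B N}

theorem rhsChain_analyticAt {s : ℕ → ℂ} (ord : ℕ → ℕ) (b : Fin m → ℂ)
    (hB : MatAnalyticAt B (s 0)) (t : ℕ) : MatAnalyticAt (rhsChain K B N s ord b t) (s t) := by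
  cases t with
  | zero => exact hB.mul (MatAnalyticAt.const _ _)
  | succ t => exact MatAnalyticAt.const _ _

theorem rhsChain_congr {s s' : ℕ → ℂ} {ord ord' : ℕ → ℕ} (b : Fin m → ℂ) (t : ℕ)
    (h : ∀ i < t, s i = s' i) (h' : ∀ i < t, ord i = ord' i) :
    rhsChain K B N s ord b t = rhsChain K B N s' ord' b t := by
  induction t with
  | zero => rfl
  | succ t ih =>
    simp only [rhsChain, h t t.lt_succ_self, h' t t.lt_succ_self,
      ih (fun i hi => h i (hi.trans t.lt_succ_self)) fun i hi => h' i (hi.trans t.lt_succ_self)]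

theorem mDeriv_mul_rhsChain_succ {ρ : Type*} {s : ℕ → ℂ} (ord : ℕ → ℕ) (b : Fin m → ℂ)
    {t : ℕ} {ψ : ℂ → Matrix ρ (Fin n) ℂ} (hψ : MatAnalyticAt ψ (s (t + 1)))
    (hK : MatAnalyticAt K (s (t + 1))) (hKu : IsUnit (K (s (t + 1))).det) (j : ℕ) :
    mDeriv j (fun z => ψ z * ((K z)⁻¹ * rhsChain K B N s ord b (t + 1) z)) (s (t + 1)) =
      mDeriv j (fun w => ψ w * (K w)⁻¹) (s (t + 1)) * rhsChain K B N s ord b (t + 1) 0 := by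
  simp only [← Matrix.mul_assoc (ψ _)]
  exact mDeriv_mul_const _ (hψ.mul (hK.inv hKu)) j

theorem mDeriv_mul_rhsChain_succ_apply {ρ : Type*} {s : ℕ → ℂ} (ord : ℕ → ℕ) (b : Fin m → ℂ)
    {t : ℕ} {ψ : ℂ → Matrix ρ (Fin n) ℂ} (hψ : MatAnalyticAt ψ (s (t + 1)))
    (hK : ∀ i ≤ t + 1, MatAnalyticAt K (s i)) (hKu : ∀ i ≤ t + 1, IsUnit (K (s i)).det)
    (hB : MatAnalyticAt B (s 0)) (hN : ∀ ι, MatAnalyticAt (N ι) (s t)) (j : ℕ)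
    (a : ρ) (J : Fin m) (e : outT m t) :
    mDeriv j (fun z => ψ z * ((K z)⁻¹ * rhsChain K B N s ord b (t + 1) z)) (s (t + 1)) a
        (outCons J e) =
      mDeriv (ord t) (fun z => mDeriv j (fun w => ψ w * (K w)⁻¹) (s (t + 1)) * N J z *
        ((K z)⁻¹ * rhsChain K B N s ord b t z)) (s t) a e := by
  have hv := ((hK t t.le_succ).inv (hKu t t.le_succ)).mul
    (rhsChain_analyticAt (K := K) (N := N) ord b hB t)
  simp only [Matrix.mul_assoc _ (N J _)]
  rw [mDeriv_const_mul _ ((hN J).mul hv),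
    mDeriv_mul_rhsChain_succ ord b hψ (hK _ le_rfl) (hKu _ le_rfl)]
  rfl

/-- The mixed partial derivatives of a separated product chain, contracted with `I ⊗ b`. -/
theorem mixedD_mul_tangMat {ρ : Type*} {s : ℕ → ℂ} (ord : ℕ → ℕ) (b : Fin m → ℂ) (t : ℕ)
    {ψ : ℂ → Matrix ρ (Fin n) ℂ} (hψ : MatAnalyticAt ψ (s t))
    (hK : ∀ i ≤ t, MatAnalyticAt K (s i)) (hKu : ∀ i ≤ t, IsUnit (K (s i)).det)
    (hB : MatAnalyticAt B (s 0)) (hN : ∀ i < t, ∀ ι, MatAnalyticAt (N ι) (s i)) :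
    (Matrix.of fun a cc =>
        mixedD ord (t + 1) (fun s' => (ψ (s' t) * Zblk K B N s' t) a cc) s) * tangMat b t =
      mDeriv (ord t) (fun z => ψ z * ((K z)⁻¹ * rhsChain K B N s ord b t z)) (s t) := by
  induction t generalizing ψ with
  | zero =>
    have hE : (Matrix.of fun a cc =>
        mixedD ord 1 (fun s' => (ψ (s' 0) * Zblk K B N s' 0) a cc) s) =
        mDeriv (ord 0) (fun z => ψ z * ((K z)⁻¹ * B z)) (s 0) := by
      ext a cc
      change (pD 0)^[ord 0] _ s = _
      rw [iterate_pD]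
      simp only [Zblk, Function.update_self]
      rfl
    rw [hE]
    change mDeriv (ord 0) (fun z => ψ z * ((K z)⁻¹ * B z)) (s 0) * bCol b =
      mDeriv (ord 0) (fun z => ψ z * ((K z)⁻¹ * (B z * bCol b))) (s 0)
    rw [← mDeriv_mul_const _ (hψ.mul (((hK 0 le_rfl).inv (hKu 0 le_rfl)).mul hB))]
    simp only [Matrix.mul_assoc]
  | succ t ih =>
    ext a je
    obtain ⟨J, e, rfl⟩ := exists_outCons je
    have hψK := hψ.mul ((hK _ le_rfl).inv (hKu _ le_rfl))
    rw [mDeriv_mul_rhsChain_succ_apply ord b hψ hK hKu hB (hN t t.lt_succ_self)]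
    set A := mDeriv (ord (t + 1)) (fun w => ψ w * (K w)⁻¹) (s (t + 1)) with hA
    rw [← ih ((MatAnalyticAt.const A _).mul (hN t t.lt_succ_self J))
      (fun i hi => hK i (hi.trans t.le_succ)) (fun i hi => hKu i (hi.trans t.le_succ))
      fun i hi => hN i (hi.trans t.lt_succ_self)]
    have hstep : ∀ cc : colT m t,
        mixedD ord (t + 1 + 1)
          (fun s' => (ψ (s' (t + 1)) * Zblk K B N s' (t + 1)) a (colCons J cc)) s =
        mixedD ord (t + 1) (fun s' => (A * N J (s' t) * Zblk K B N s' t) a cc) s := by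
      intro cc
      refine mixedD_congr ord (t + 1) fun s' hs' => ?_
      have hZ : ∀ z, Zblk K B N (Function.update s' (t + 1) z) t = Zblk K B N s' t := fun z =>
        Zblk_congr K B N t fun i hi => Function.update_of_ne (by omega) _ _
      have hf : ∀ z, (ψ z * Zblk K B N (Function.update s' (t + 1) z) (t + 1)) a (colCons J cc) =
          (ψ z * (K z)⁻¹ * (N J (s' t) * Zblk K B N s' t)) a cc := by
        intro z
        rw [Matrix.mul_assoc (ψ z), Matrix.mul_apply, Matrix.mul_apply]
        refine Finset.sum_congr rfl fun x _ => ?_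
        rw [Zblk_succ_apply, hZ, Function.update_self,
          Function.update_of_ne (show t ≠ t + 1 by omega)]
      rw [iterate_pD]
      simp only [Function.update_self, hf]
      rw [hs' _ le_rfl, Matrix.mul_assoc, hA, ← mDeriv_mul_const _ hψK]
      rfl
    rw [Matrix.mul_apply, Matrix.mul_apply, sum_colT_succ]
    have htang : ∀ (J' : Fin m) (cc : colT m t),
        tangMat b (t + 1) (colCons J' cc) (outCons J e) =
          if J' = J then tangMat b t cc e else 0 := by
      intro J' cc
      change ((1 : Matrix (Fin m) (Fin m) ℂ) ⊗ₖ tangMat b t) (J', cc) (J, e) = _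
      simp [Matrix.one_apply]
    simp only [htang, Matrix.of_apply, mul_ite, mul_zero]
    rw [Finset.sum_comm]
    simp only [Finset.sum_ite_eq', Finset.mem_univ, if_true, hstep]

theorem hChainB_eq_rhsChain {s : ℕ → ℂ} (ord : ℕ → ℕ) (b : Fin m → ℂ) (t : ℕ)
    (hK : ∀ i ≤ t, MatAnalyticAt K (s i)) (hKu : ∀ i ≤ t, IsUnit (K (s i)).det)
    (hN : ∀ i ≤ t, ∀ ι, MatAnalyticAt (N ι) (s i)) (z : ℂ) :
    hChainB K B N s ord b t = rhsChain K B N s ord b (t + 1) z := by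
  induction t generalizing z with
  | zero =>
    ext i je
    obtain ⟨J, e, rfl⟩ := exists_outCons je
    change iteratedDeriv (ord 0) (fun z => (Nbig N z *
      ((1 : Matrix (Fin m) (Fin m) ℂ) ⊗ₖ ((K z)⁻¹ * B z * bCol b))) i (J, e)) (s 0) =
      iteratedDeriv (ord 0) (fun z => (N J z * ((K z)⁻¹ * (B z * bCol b))) i e) (s 0)
    refine congrArg (fun f => iteratedDeriv (ord 0) f (s 0)) (funext fun z => ?_)
    rw [← Matrix.mul_assoc (K z)⁻¹]
    exact Nbig_mul_kronecker_apply N z _ i J e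
  | succ t ih =>
    ext i je
    obtain ⟨J, e, rfl⟩ := exists_outCons je
    have hL : rhsChain K B N s ord b (t + 1 + 1) z i (outCons J e) =
        mDeriv (ord (t + 1)) (fun z => N J z * ((K z)⁻¹ * rhsChain K B N s ord b (t + 1) z))
          (s (t + 1)) i e := rfl
    rw [hL, mDeriv_mul_rhsChain_succ ord b (hN _ le_rfl J) (hK _ le_rfl) (hKu _ le_rfl),
      ← ih (fun i hi => hK i (hi.trans t.le_succ)) (fun i hi => hKu i (hi.trans t.le_succ))
        (fun i hi => hN i (hi.trans t.le_succ)) 0]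
    change (mDeriv (ord (t + 1))
        (fun z => Nbig N z * ((1 : Matrix (Fin m) (Fin m) ℂ) ⊗ₖ (K z)⁻¹)) (s (t + 1)) *
        ((1 : Matrix (Fin m) (Fin m) ℂ) ⊗ₖ hChainB K B N s ord b t)) i (J, e) = _
    simp [Matrix.mul_apply, Fintype.sum_prod_type, Matrix.one_apply, mDeriv, Nbig]

theorem vHermB_eq_mDeriv {s : ℕ → ℂ} (ord : ℕ → ℕ) (b : Fin m → ℂ) (t : ℕ)
    (hK : ∀ i ≤ t, MatAnalyticAt K (s i)) (hKu : ∀ i ≤ t, IsUnit (K (s i)).det)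
    (hN : ∀ i < t, ∀ ι, MatAnalyticAt (N ι) (s i)) (j : ℕ) :
    vHermB K B N s ord b t j =
      mDeriv j (fun z => (K z)⁻¹ * rhsChain K B N s ord b t z) (s t) := by
  cases t with
  | zero =>
    simp only [vHermB, rhsChain, Matrix.mul_assoc]
    rfl
  | succ t =>
    rw [vHermB, hChainB_eq_rhsChain ord b t (fun i hi => hK i (hi.trans t.le_succ))
      (fun i hi => hKu i (hi.trans t.le_succ)) (fun i hi => hN i (Nat.lt_succ_of_le hi)) 0]
    exact (mDeriv_mul_const _ ((hK _ le_rfl).inv (hKu _ le_rfl)) j).symm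

/-- The right-hand sides of the reduced-order chain are the projections of the full ones. -/
theorem rhsChain_projection {r : ℕ} {s : ℕ → ℂ} (ord : ℕ → ℕ) (b : Fin m → ℂ)
    (V : Matrix (Fin n) (Fin r) ℂ) (W : Matrix (Fin r) (Fin n) ℂ) (t : ℕ)
    (hK : ∀ i < t, MatAnalyticAt K (s i)) (hKu : ∀ i < t, IsUnit (K (s i)).det)
    (hKr : ∀ i < t, IsUnit (W * K (s i) * V).det)
    (hB : MatAnalyticAt B (s 0)) (hN : ∀ i < t, ∀ ι, MatAnalyticAt (N ι) (s i))
    (hV : ∀ i < t, ∀ j ≤ ord i, ∃ D : Matrix (Fin r) (outT m i) ℂ,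
      mDeriv j (fun z => (K z)⁻¹ * rhsChain K B N s ord b i z) (s i) = V * D) (z : ℂ) :
    rhsChain (fun z => W * K z * V) (fun z => W * B z) (fun ι z => W * N ι z * V) s ord b t z =
      W * rhsChain K B N s ord b t z := by
  induction t generalizing z with
  | zero =>
    simp only [rhsChain, Matrix.mul_assoc]
    rfl
  | succ t ih =>
    have ih := ih (fun i hi => hK i (hi.trans t.lt_succ_self))
      (fun i hi => hKu i (hi.trans t.lt_succ_self)) (fun i hi => hKr i (hi.trans t.lt_succ_self))
      (fun i hi => hN i (hi.trans t.lt_succ_self)) fun i hi => hV i (hi.trans t.lt_succ_self)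
    have hKt := hK t t.lt_succ_self
    have hWa : MatAnalyticAt (fun _ => W) (s t) := .const _ _
    have hVa : MatAnalyticAt (fun _ => V) (s t) := .const _ _
    have hy := rhsChain_analyticAt (K := K) (N := N) ord b hB t
    have hv := (hKt.inv (hKu t t.lt_succ_self)).mul hy
    have hvr := (((hWa.mul hKt).mul hVa).inv (hKr t t.lt_succ_self)).mul (hWa.mul hy)
    have hP := projection_right V W hKt hy (hKu t t.lt_succ_self) (hKr t t.lt_succ_self)
      (hV t t.lt_succ_self)
    have key : ∀ J, mDeriv (ord t) (fun z => W * N J z * V *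
        ((W * K z * V)⁻¹ * (W * rhsChain K B N s ord b t z))) (s t) =
        W * mDeriv (ord t) (fun z => N J z * ((K z)⁻¹ * rhsChain K B N s ord b t z)) (s t) := by
      intro J
      have hNJ := hN t t.lt_succ_self J
      rw [← mDeriv_const_mul _ (hNJ.mul hv)]
      simp only [← Matrix.mul_assoc W (N J _), Matrix.mul_assoc _ V]
      refine mDeriv_mul_congr_right (hWa.mul hNJ) (hVa.mul hvr) hv fun j hj => ?_
      rw [mDeriv_const_mul V hvr, hP j hj]
    ext i je
    obtain ⟨J, e, rfl⟩ := exists_outCons je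
    change mDeriv (ord t) (fun z => W * N J z * V * ((W * K z * V)⁻¹ *
      rhsChain (fun z => W * K z * V) (fun z => W * B z) (fun ι z => W * N ι z * V) s ord b t z))
      (s t) i e = _
    simp only [ih, key]
    rfl

variable {p : ℕ} (C : ℂ → Matrix (Fin p) (Fin n) ℂ) (K N)

/-- Left-hand sides of the linear systems with matrix `K` defining the blockwise left Hermite
matrices: `cᴴ C` at level `0`, and the block rows `∂^{eν t}(x_t K⁻¹)(τ t) N_J` at level `t + 1`. -/
noncomputable def lhsChain (τ : ℕ → ℂ) (eν : ℕ → ℕ) (c : Fin p → ℂ) :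
    (t : ℕ) → ℂ → Matrix (outT m t) (Fin n) ℂ
  | 0 => fun z => (Matrix.of fun _ : outT m 0 => star c) * C z
  | t + 1 => fun z => Matrix.of fun (je : Fin m × outT m t) i =>
      (mDeriv (eν t) (fun z => lhsChain τ eν c t z * (K z)⁻¹) (τ t) * N je.1 z) je.2 i

variable {C K N}

theorem lhsChain_analyticAt (τ : ℕ → ℂ) (eν : ℕ → ℕ) (c : Fin p → ℂ) {z : ℂ}
    (hC : MatAnalyticAt C z) (hN : ∀ ι, MatAnalyticAt (N ι) z) (t : ℕ) :
    MatAnalyticAt (lhsChain K N C τ eν c t) z := by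
  cases t with
  | zero => exact (MatAnalyticAt.const _ _).mul hC
  | succ t =>
    intro je i
    exact ((MatAnalyticAt.const _ _).mul (hN je.1)) je.2 i

theorem wHermB_conjTranspose (τ : ℕ → ℂ) (eν : ℕ → ℕ) (c : Fin p → ℂ) (t j : ℕ) :
    (wHermB C K N τ eν c t j)ᴴ =
      mDeriv j (fun z => lhsChain K N C τ eν c t z * (K z)⁻¹) (τ t) := by
  induction t generalizing j with
  | zero =>
    ext x i
    simp only [wHermB, Matrix.conjTranspose_apply, Matrix.of_apply, star_star, mDeriv, lhsChain,
      Matrix.mul_assoc]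
    rfl
  | succ t ih =>
    ext je i
    obtain ⟨J, e, rfl⟩ := exists_outCons je
    have hrow : ∀ z, (((1 : Matrix (Fin m) (Fin m) ℂ) ⊗ₖ wHermB C K N τ eν c t (eν t))ᴴ *
        Ntil N z * (K z)⁻¹) (J, e) i =
        ((wHermB C K N τ eν c t (eν t))ᴴ * N J z * (K z)⁻¹) e i := by
      intro z
      rw [Matrix.mul_apply, Matrix.mul_apply]
      refine Finset.sum_congr rfl fun x _ => ?_
      congr 1
      simp [Matrix.mul_apply, Fintype.sum_prod_type, Matrix.one_apply, Ntil, apply_ite]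
    change star (star (iteratedDeriv j (fun z =>
      (((1 : Matrix (Fin m) (Fin m) ℂ) ⊗ₖ wHermB C K N τ eν c t (eν t))ᴴ * Ntil N z *
        (K z)⁻¹) (J, e) i) (τ (t + 1)))) = _
    simp only [hrow, star_star, ih]
    rfl

/-- Two-sided Hermite interpolation of the chains: the projected chain has the same derivatives
as the full one. -/
theorem mDeriv_lhsChain_mul_rhsChain_projection {r : ℕ} {s τ : ℕ → ℂ} {ord eν : ℕ → ℕ}
    (b : Fin m → ℂ) (c : Fin p → ℂ) (V : Matrix (Fin n) (Fin r) ℂ)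
    (W : Matrix (Fin r) (Fin n) ℂ) {q η : ℕ}
    (hC : ∀ i ≤ q + 1 + η, MatAnalyticAt C (s i)) (hK : ∀ i ≤ q + 1 + η, MatAnalyticAt K (s i))
    (hKu : ∀ i ≤ q + 1 + η, IsUnit (K (s i)).det)
    (hKr : ∀ i ≤ q + 1 + η, IsUnit (W * K (s i) * V).det) (hB : MatAnalyticAt B (s 0))
    (hN : ∀ i ≤ q + 1 + η, ∀ ι, MatAnalyticAt (N ι) (s i))
    (hV : ∀ i ≤ q, ∀ j ≤ ord i, ∃ D : Matrix (Fin r) (outT m i) ℂ,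
      mDeriv j (fun z => (K z)⁻¹ * rhsChain K B N s ord b i z) (s i) = V * D)
    (hW : ∀ h ≤ η, ∀ j ≤ eν h, ∃ D : Matrix (outT m h) (Fin r) ℂ,
      mDeriv j (fun z => lhsChain K N C τ eν c h z * (K z)⁻¹) (τ h) = D * W)
    (hτ : ∀ t h, t + h = η → s (q + 1 + t) = τ h) (hord : ord (q + 1) ≤ eν η)
    (hord' : ∀ t h, t + 1 + h = η → ord (q + 1 + (t + 1)) = eν h) (t h : ℕ) (hth : t + h = η) :
    mDeriv (ord (q + 1 + t)) (fun z => lhsChain K N C τ eν c h z * V * ((W * K z * V)⁻¹ *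
        rhsChain (fun z => W * K z * V) (fun z => W * B z) (fun ι z => W * N ι z * V) s ord b
          (q + 1 + t) z)) (s (q + 1 + t)) =
      mDeriv (ord (q + 1 + t)) (fun z => lhsChain K N C τ eν c h z * ((K z)⁻¹ *
        rhsChain K B N s ord b (q + 1 + t) z)) (s (q + 1 + t)) := by
  have hWa : ∀ z, MatAnalyticAt (fun _ => W) z := fun _ => .const _ _
  have hVa : ∀ z, MatAnalyticAt (fun _ => V) z := fun _ => .const _ _
  have hKra : ∀ i ≤ q + 1 + η, MatAnalyticAt (fun z => W * K z * V) (s i) := fun i hi =>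
    ((hWa _).mul (hK i hi)).mul (hVa _)
  have hx : ∀ i ≤ q + 1 + η, ∀ h, MatAnalyticAt (lhsChain K N C τ eν c h) (s i) :=
    fun i hi h => lhsChain_analyticAt τ eν c (hC i hi) (hN i hi) h
  have hP : ∀ t h, t + h = η → ∀ j ≤ eν h,
      mDeriv j (fun z => lhsChain K N C τ eν c h z * V * (W * K z * V)⁻¹) (s (q + 1 + t)) * W =
        mDeriv j (fun z => lhsChain K N C τ eν c h z * (K z)⁻¹) (s (q + 1 + t)) := by
    intro t h hth
    refine projection_left V W (hK _ (by omega)) (hx _ (by omega) h) (hKu _ (by omega))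
      (hKr _ (by omega)) ?_
    rw [hτ t h hth]
    exact hW h (by omega)
  induction t generalizing h with
  | zero =>
    obtain rfl : h = η := by omega
    have hR := rhsChain_projection ord b V W (q + 1) (fun i hi => hK i (by omega))
      (fun i hi => hKu i (by omega)) (fun i hi => hKr i (by omega)) hB
      (fun i hi => hN i (by omega)) (fun i hi => hV i (by omega))
    simp only [Nat.add_zero] at hP ⊢
    rw [mDeriv_mul_rhsChain_succ (K := fun z => W * K z * V) ord b
        ((hx _ (by omega) h).mul (hVa _)) (hKra _ (by omega)) (hKr _ (by omega)),
      mDeriv_mul_rhsChain_succ ord b (hx _ (by omega) h) (hK _ (by omega)) (hKu _ (by omega)),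
      hR, ← Matrix.mul_assoc]
    congr 1
    exact hP 0 h hth _ hord
  | succ t ih =>
    have hA := hP (t + 1) h hth (eν h) le_rfl
    have hd := hord' t h hth
    have hs := hτ (t + 1) h hth
    rw [← Nat.add_assoc] at hA hd hs ⊢
    ext a je
    obtain ⟨J, e, rfl⟩ := exists_outCons je
    rw [mDeriv_mul_rhsChain_succ_apply ord b (hx _ (by omega) h)
        (fun i hi => hK i (by omega)) (fun i hi => hKu i (by omega)) hB (hN _ (by omega)),
      mDeriv_mul_rhsChain_succ_apply (K := fun z => W * K z * V) (B := fun z => W * B z)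
        (N := fun ι z => W * N ι z * V) ord b
        ((hx _ (by omega) h).mul (hVa _)) (fun i hi => hKra i (by omega))
        (fun i hi => hKr i (by omega)) ((hWa _).mul hB)
        (fun ι => ((hWa _).mul (hN _ (by omega) ι)).mul (hVa _)), hd]
    simp only [← Matrix.mul_assoc _ _ V, ← Matrix.mul_assoc _ W, hA]
    rw [hs]
    exact congrFun (congrFun (ih (h + 1) (by omega)) (outCons J a)) e

end Chains

theorem stmt_13 {n m p r : ℕ} (hn : 0 < n) (hm : 0 < m) (hp : 0 < p) (hr : 0 < r)
    (C : ℂ → Matrix (Fin p) (Fin n) ℂ) (K : ℂ → Matrix (Fin n) (Fin n) ℂ)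
    (B : ℂ → Matrix (Fin n) (Fin m) ℂ) (N : Fin m → ℂ → Matrix (Fin n) (Fin n) ℂ)
    (V W : Matrix (Fin n) (Fin r) ℂ)
    (k κ : ℕ) (hk : 0 < k) (hκ : 0 < κ) (σ ς : ℕ → ℂ) (ℓ ν : ℕ → ℕ) (b : Fin m → ℂ)
    (c : Fin p → ℂ)
    (hCa : ∀ j < k, ∀ a e, AnalyticAt ℂ (fun z => C z a e) (σ j))
    (hKa : ∀ j < k, ∀ a e, AnalyticAt ℂ (fun z => K z a e) (σ j))
    (hBa : ∀ j < k, ∀ a e, AnalyticAt ℂ (fun z => B z a e) (σ j))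
    (hNa : ∀ j < k, ∀ ι a e, AnalyticAt ℂ (fun z => N ι z a e) (σ j))
    (hCa' : ∀ i < κ, ∀ a e, AnalyticAt ℂ (fun z => C z a e) (ς i))
    (hKa' : ∀ i < κ, ∀ a e, AnalyticAt ℂ (fun z => K z a e) (ς i))
    (hBa' : ∀ i < κ, ∀ a e, AnalyticAt ℂ (fun z => B z a e) (ς i))
    (hNa' : ∀ i < κ, ∀ ι a e, AnalyticAt ℂ (fun z => N ι z a e) (ς i))
    (hK : ∀ j < k, IsUnit (K (σ j)).det)
    (hK' : ∀ i < κ, IsUnit (K (ς i)).det)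
    (hKr : ∀ j < k, IsUnit (Wᴴ * K (σ j) * V).det)
    (hKr' : ∀ i < κ, IsUnit (Wᴴ * K (ς i) * V).det)
    (hV : ∀ t < k, ∀ j ≤ ℓ t, ∀ cix : outT m t,
      (fun i => vHermB K B N σ ℓ b t j i cix) ∈ Set.range V.mulVec)
    (hW : ∀ t < κ, ∀ j ≤ ν (κ - 1 - t), ∀ cix : outT m t,
      (fun i =>
        wHermB C K N (fun t => ς (κ - 1 - t)) (fun t => ν (κ - 1 - t)) c t j i cix) ∈
          Set.range W.mulVec) :
    ∀ q < k, ∀ η < κ, ∀ jq ≤ ℓ q, ∀ i ≤ ν (κ - 1 - η),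
      Matrix.vecMul (star c)
          ((Matrix.of fun a cc =>
            mixedD
              (fun t =>
                if t < q then ℓ t
                else if t = q then jq
                else if t = q + 1 then i
                else ν (κ - 1 - η + (t - (q + 1)))) (q + η + 2)
              (fun s => Gblk C K B N s (q + η + 1) a cc)
              (fun j => if j ≤ q then σ j else ς (κ - 1 - η + (j - (q + 1))))) *
            tangMat b (q + η + 1)) =
        Matrix.vecMul (star c)
          ((Matrix.of fun a cc =>
            mixedD
              (fun t =>
                if t < q then ℓ t
                else if t = q then jq
                else if t = q + 1 then i
                else ν (κ - 1 - η + (t - (q + 1)))) (q + η + 2)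
              (fun s => Gblk (fun s => C s * V) (fun s => Wᴴ * K s * V) (fun s => Wᴴ * B s) (fun ι s => Wᴴ * N ι s * V) s (q + η + 1) a cc)
              (fun j => if j ≤ q then σ j else ς (κ - 1 - η + (j - (q + 1))))) *
            tangMat b (q + η + 1)) := by
  intro q hq η hη jq hjq i hi
  set ord : ℕ → ℕ := fun t =>
    if t < q then ℓ t
    else if t = q then jq
    else if t = q + 1 then i
    else ν (κ - 1 - η + (t - (q + 1))) with hord
  set s : ℕ → ℂ := fun j => if j ≤ q then σ j else ς (κ - 1 - η + (j - (q + 1))) with hs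
  have hs_le : ∀ t ≤ q, s t = σ t := fun t ht => if_pos ht
  have hs_gt : ∀ t, s (q + 1 + t) = ς (κ - 1 - η + t) := fun t => by
    simp only [hs]
    rw [if_neg (by omega), show q + 1 + t - (q + 1) = t by omega]
  have hpt : ∀ {P : ℂ → Prop}, (∀ j < k, P (σ j)) → (∀ j < κ, P (ς j)) →
      ∀ t ≤ q + 1 + η, P (s t) := by
    intro P h1 h2 t ht
    rcases Nat.lt_or_ge q t with hlt | hle
    · obtain ⟨d, rfl⟩ := Nat.exists_eq_add_of_le hlt
      change P (s (q + 1 + d))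
      rw [hs_gt]
      exact h2 _ (by omega)
    · rw [hs_le t hle]
      exact h1 t (by omega)
  have hCs : ∀ t ≤ q + 1 + η, MatAnalyticAt C (s t) := hpt hCa hCa'
  have hKs : ∀ t ≤ q + 1 + η, MatAnalyticAt K (s t) := hpt hKa hKa'
  have hBs : ∀ t ≤ q + 1 + η, MatAnalyticAt B (s t) := hpt hBa hBa'
  have hNs : ∀ t ≤ q + 1 + η, ∀ ι, MatAnalyticAt (N ι) (s t) :=
    hpt (P := fun z => ∀ ι, MatAnalyticAt (N ι) z) hNa hNa'
  have hKu : ∀ t ≤ q + 1 + η, IsUnit (K (s t)).det :=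
    hpt (P := fun z => IsUnit (K z).det) hK hK'
  have hKru : ∀ t ≤ q + 1 + η, IsUnit (Wᴴ * K (s t) * V).det :=
    hpt (P := fun z => IsUnit (Wᴴ * K z * V).det) hKr hKr'
  have hord_lt : ∀ t < q, ord t = ℓ t := fun t ht => if_pos ht
  have hord_le : ∀ t ≤ q, ord t ≤ ℓ t := by
    intro t ht
    rcases ht.lt_or_eq with h | rfl
    · exact (hord_lt t h).le
    · simpa [hord] using hjq
  have hWa : ∀ z, MatAnalyticAt (fun _ => Wᴴ) z := fun _ => .const _ _
  have hVa : ∀ z, MatAnalyticAt (fun _ => V) z := fun _ => .const _ _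
  have key := mDeriv_lhsChain_mul_rhsChain_projection (s := s)
    (τ := fun t => ς (κ - 1 - t)) (ord := ord) (eν := fun t => ν (κ - 1 - t)) (q := q) (η := η)
    b c V Wᴴ hCs hKs hKu hKru (hBs 0 (by omega)) hNs
    (fun t ht j hj => by
      obtain ⟨D, hD⟩ := exists_eq_mul_of_col_mem_range (hV t (by omega) j (hj.trans (hord_le t ht)))
      refine ⟨D, ?_⟩
      rw [← hD, vHermB_eq_mDeriv ℓ b t (fun i hi => hKa i (by omega))
        (fun i hi => hK i (by omega)) (fun i hi => hNa i (by omega)), hs_le t ht,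
        rhsChain_congr b t (fun i hi => hs_le i (by omega)) fun i hi => hord_lt i (by omega)])
    (fun t ht j hj => by
      obtain ⟨D, hD⟩ := exists_eq_mul_of_col_mem_range (hW t (by omega) j hj)
      refine ⟨Dᴴ, ?_⟩
      rw [← Matrix.conjTranspose_mul, ← hD, wHermB_conjTranspose])
    (fun t h hth => by rw [hs_gt, show κ - 1 - η + t = κ - 1 - h by omega])
    (by simpa [hord] using hi)
    (fun t h hth => by
      simp only [hord]
      rw [if_neg (by omega), if_neg (by omega), if_neg (by omega)]
      congr 1
      omega) η 0 (by omega)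
  have hQ : q + η + 1 = q + 1 + η := by omega
  rw [show q + η + 2 = q + 1 + η + 1 by omega, hQ]
  have hfull := mixedD_mul_tangMat (N := N) ord b (q + 1 + η) (hCs _ le_rfl) hKs hKu
    (hBs 0 (by omega)) fun i hi => hNs i hi.le
  have hred := mixedD_mul_tangMat (K := fun z => Wᴴ * K z * V) (B := fun z => Wᴴ * B z)
    (N := fun ι z => Wᴴ * N ι z * V) ord b (q + 1 + η) ((hCs _ le_rfl).mul (hVa _))
    (fun i hi => ((hWa _).mul (hKs i hi)).mul (hVa _)) hKru ((hWa _).mul (hBs 0 (by omega)))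
    fun i hi ι => ((hWa _).mul (hNs i hi.le ι)).mul (hVa _)
  simp only [Gblk]
  rw [hfull, hred]
  have hvf := ((hKs _ le_rfl).inv (hKu _ le_rfl)).mul
    (rhsChain_analyticAt (K := K) (N := N) ord b (hBs 0 (by omega)) (q + 1 + η))
  have hvr := ((((hWa _).mul (hKs _ le_rfl)).mul (hVa _)).inv (hKru _ le_rfl)).mul
    (rhsChain_analyticAt (K := fun z => Wᴴ * K z * V) (N := fun ι z => Wᴴ * N ι z * V) ord b
      ((hWa _).mul (hBs 0 (by omega))) (q + 1 + η))
  simp only [lhsChain, Matrix.mul_assoc (Matrix.of fun _ : outT m 0 => star c)] at key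
  rw [mDeriv_const_mul _ (((hCs _ le_rfl).mul (hVa _)).mul hvr),
    mDeriv_const_mul _ ((hCs _ le_rfl).mul hvf)] at key
  exact (congrFun key (0 : Fin 1)).symm

end StructBilin
end

section
/- Suppose C, K, B, and all N_j are analytic at σ_1,…,σ_k ∈ ℂ and that K(σ_i) and K̂(σ_i) = Wᴴ K(σ_i) V are invertible for all i = 1,…,k. Let b ∈ ℂ^m and c ∈ ℂ^p. Let the column space of V contain the columns of V_1 = K(σ_1)^{-1} B(σ_1) b and V_j = K(σ_j)^{-1} N(σ_{j-1}) (I_m ⊗ V_{j-1}) for 2 ≤ j ≤ k, and let the column space of W contain the columns of W_1 = K(σ_k)^{-ᴴ} C(σ_k)ᴴ c and W_i = K(σ_{k-i+1})^{-ᴴ} Ñ(σ_{k-i+1})ᴴ (I_m ⊗ W_{i-1}) for 2 ≤ i ≤ k (i.e., identical interpolation points on both sides). Then, in addition, all first-order partial derivatives with respect to s_1,…,s_k of the function (s_1,…,s_k) ↦ cᴴ G_k(s_1,…,s_k)(I_{m^{k-1}} ⊗ b) coincide with those of (s_1,…,s_k) ↦ cᴴ Ĝ_k(s_1,…,s_k)(I_{m^{k-1}}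 ⊗ b) when evaluated at (σ_1,…,σ_k). -/
open Matrix
open scoped Kronecker

namespace StructBilin

section EntrywiseDifferentiability

variable {ι κ μ : Type*} [Fintype κ] {z₀ : ℂ}

lemma differentiableAt_matrix_mul {A : ℂ → Matrix ι κ ℂ} {A' : ℂ → Matrix κ μ ℂ}
    (hA : ∀ i j, DifferentiableAt ℂ (fun z => A z i j) z₀)
    (hA' : ∀ i j, DifferentiableAt ℂ (fun z => A' z i j) z₀) (i : ι) (j : μ) :
    DifferentiableAt ℂ (fun z => (A z * A' z) i j) z₀ := by
  simp only [Matrix.mul_apply]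
  exact DifferentiableAt.fun_sum fun l _ => (hA i l).mul (hA' l j)

lemma differentiableAt_mulVec {A : ℂ → Matrix ι κ ℂ} {x : ℂ → κ → ℂ}
    (hA : ∀ i j, DifferentiableAt ℂ (fun z => A z i j) z₀)
    (hx : ∀ j, DifferentiableAt ℂ (fun z => x z j) z₀) (i : ι) :
    DifferentiableAt ℂ (fun z => (A z *ᵥ x z) i) z₀ := by
  simp only [Matrix.mulVec, dotProduct]
  exact DifferentiableAt.fun_sum fun l _ => (hA i l).mul (hx l)

lemma differentiableAt_vecMul {A : ℂ → Matrix κ ι ℂ} {x : ℂ → κ → ℂ}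
    (hA : ∀ i j, DifferentiableAt ℂ (fun z => A z i j) z₀)
    (hx : ∀ j, DifferentiableAt ℂ (fun z => x z j) z₀) (i : ι) :
    DifferentiableAt ℂ (fun z => (x z ᵥ* A z) i) z₀ := by
  simp only [Matrix.vecMul, dotProduct]
  exact DifferentiableAt.fun_sum fun l _ => (hx l).mul (hA l i)

lemma differentiableAt_dotProduct {x y : ℂ → κ → ℂ}
    (hx : ∀ j, DifferentiableAt ℂ (fun z => x z j) z₀)
    (hy : ∀ j, DifferentiableAt ℂ (fun z => y z j) z₀) :
    DifferentiableAt ℂ (fun z => x z ⬝ᵥ y z) z₀ := by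
  simp only [dotProduct]
  exact DifferentiableAt.fun_sum fun l _ => (hx l).mul (hy l)

lemma hasDerivAt_dotProduct_of_eq_zero {x y : ℂ → κ → ℂ}
    (hx : ∀ j, DifferentiableAt ℂ (fun z => x z j) z₀)
    (hy : ∀ j, DifferentiableAt ℂ (fun z => y z j) z₀) (hx0 : x z₀ = 0) (hy0 : y z₀ = 0) :
    HasDerivAt (fun z => x z ⬝ᵥ y z) 0 z₀ := by
  have h := HasDerivAt.fun_sum (u := Finset.univ)
    fun j _ => (hx j).hasDerivAt.mul (hy j).hasDerivAt
  simpa [dotProduct, hx0, hy0] using h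

variable [DecidableEq κ]

lemma differentiableAt_det {A : ℂ → Matrix κ κ ℂ}
    (hA : ∀ i j, DifferentiableAt ℂ (fun z => A z i j) z₀) :
    DifferentiableAt ℂ (fun z => (A z).det) z₀ := by
  simp only [Matrix.det_apply']
  exact DifferentiableAt.fun_sum fun e _ =>
    (DifferentiableAt.fun_finsetProd fun i _ => hA (e i) i).const_mul _

lemma differentiableAt_matrix_inv {A : ℂ → Matrix κ κ ℂ}
    (hA : ∀ i j, DifferentiableAt ℂ (fun z => A z i j) z₀) (hdet : IsUnit (A z₀).det)
    (i j : κ) : DifferentiableAt ℂ (fun z => (A z)⁻¹ i j) z₀ := by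
  simp only [Matrix.inv_def, Ring.inverse_eq_inv', Matrix.smul_apply, smul_eq_mul,
    Matrix.adjugate_apply]
  refine ((differentiableAt_det hA).inv hdet.ne_zero).mul (differentiableAt_det fun a e => ?_)
  by_cases h : a = j
  · subst h
    simp
  · simpa [Matrix.updateRow_ne h] using hA a e

lemma eventually_isUnit_det {A : ℂ → Matrix κ κ ℂ}
    (hA : ∀ i j, DifferentiableAt ℂ (fun z => A z i j) z₀) (hdet : IsUnit (A z₀).det) :
    ∀ᶠ z in nhds z₀, IsUnit (A z).det := by
  filter_upwards [(differentiableAt_det hA).continuousAt.eventually_ne hdet.ne_zero] with z hz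
  exact hz.isUnit

end EntrywiseDifferentiability

section Projection

variable {ι κ : Type*} [Fintype ι] [DecidableEq ι] [Fintype κ] [DecidableEq κ]

lemma petrovGalerkin_mulVec {K : Matrix ι ι ℂ} {V : Matrix ι κ ℂ} {L : Matrix κ ι ℂ}
    (hK : IsUnit K.det) (hKr : IsUnit (L * K * V).det) {x : ι → ℂ}
    (hx : K⁻¹ *ᵥ x ∈ Set.range V.mulVec) :
    V *ᵥ ((L * K * V)⁻¹ *ᵥ (L *ᵥ x)) = K⁻¹ *ᵥ x := by
  obtain ⟨g, hg⟩ := hx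
  have hx' : x = K *ᵥ (V *ᵥ g) := by
    rw [hg, Matrix.mulVec_mulVec, Matrix.mul_nonsing_inv _ hK, Matrix.one_mulVec]
  rw [← hg, hx']
  congr 1
  rw [Matrix.mulVec_mulVec, Matrix.mulVec_mulVec, Matrix.mulVec_mulVec, Matrix.mul_assoc,
    Matrix.mul_assoc, ← Matrix.mul_assoc L, Matrix.nonsing_inv_mul _ hKr, Matrix.one_mulVec]

lemma petrovGalerkin_vecMul {K : Matrix ι ι ℂ} {V : Matrix ι κ ℂ} {L : Matrix κ ι ℂ}
    (hK : IsUnit K.det) (hKr : IsUnit (L * K * V).det) {x : ι → ℂ}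
    (hx : ∃ g, x ᵥ* K⁻¹ = g ᵥ* L) :
    ((x ᵥ* V) ᵥ* (L * K * V)⁻¹) ᵥ* L = x ᵥ* K⁻¹ := by
  obtain ⟨g, hg⟩ := hx
  have hx' : x = (g ᵥ* L) ᵥ* K := by
    rw [← hg, Matrix.vecMul_vecMul, Matrix.nonsing_inv_mul _ hK, Matrix.vecMul_one]
  rw [hg, hx']
  congr 1
  rw [Matrix.vecMul_vecMul, Matrix.vecMul_vecMul, Matrix.vecMul_vecMul, ← Matrix.mul_assoc,
    ← Matrix.mul_assoc, Matrix.mul_nonsing_inv _ hKr, Matrix.vecMul_one]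

/-- The Petrov–Galerkin error `E = K⁻¹ - V (L K V)⁻¹ L` satisfies `E K E = E`. -/
lemma petrovGalerkin_error_mul {K : Matrix ι ι ℂ} {V : Matrix ι κ ℂ} {L : Matrix κ ι ℂ}
    (hK : IsUnit K.det) (hKr : IsUnit (L * K * V).det) :
    (K⁻¹ - V * (L * K * V)⁻¹ * L) * K * (K⁻¹ - V * (L * K * V)⁻¹ * L) =
      K⁻¹ - V * (L * K * V)⁻¹ * L := by
  have h : V * (L * K * V)⁻¹ * L * K * (V * (L * K * V)⁻¹ * L) = V * (L * K * V)⁻¹ * L := by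
    calc V * (L * K * V)⁻¹ * L * K * (V * (L * K * V)⁻¹ * L)
        = V * ((L * K * V)⁻¹ * (L * K * V)) * (L * K * V)⁻¹ * L := by
          simp only [Matrix.mul_assoc]
      _ = _ := by rw [Matrix.nonsing_inv_mul _ hKr, Matrix.mul_one]
  rw [Matrix.sub_mul, Matrix.nonsing_inv_mul _ hK, Matrix.sub_mul, Matrix.one_mul,
    Matrix.mul_sub, h, Matrix.mul_nonsing_inv_cancel_right _ _ hK, sub_self, sub_zero]

/-- Two-sided interpolation at a common point matches the first derivative. -/
lemma deriv_petrovGalerkin {K : ℂ → Matrix ι ι ℂ} {V : Matrix ι κ ℂ} {L : Matrix κ ι ℂ}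
    {x y : ℂ → ι → ℂ} {z₀ : ℂ}
    (hKd : ∀ i j, DifferentiableAt ℂ (fun z => K z i j) z₀)
    (hxd : ∀ i, DifferentiableAt ℂ (fun z => x z i) z₀)
    (hyd : ∀ i, DifferentiableAt ℂ (fun z => y z i) z₀)
    (hK : IsUnit (K z₀).det) (hKr : IsUnit (L * K z₀ * V).det)
    (hx : ∃ g, x z₀ ᵥ* (K z₀)⁻¹ = g ᵥ* L) (hy : (K z₀)⁻¹ *ᵥ y z₀ ∈ Set.range V.mulVec) :
    deriv (fun z => x z ⬝ᵥ ((K z)⁻¹ *ᵥ y z)) z₀ =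
      deriv (fun z => (x z ᵥ* V) ⬝ᵥ ((L * K z * V)⁻¹ *ᵥ (L *ᵥ y z))) z₀ := by
  have hVd : ∀ i j, DifferentiableAt ℂ (fun _ => V i j) z₀ := fun _ _ => differentiableAt_const _
  have hLd : ∀ i j, DifferentiableAt ℂ (fun _ => L i j) z₀ := fun _ _ => differentiableAt_const _
  have hKrd : ∀ i j, DifferentiableAt ℂ (fun z => (L * K z * V) i j) z₀ :=
    differentiableAt_matrix_mul (A := fun z => L * K z) (A' := fun _ => V)
      (differentiableAt_matrix_mul (A := fun _ => L) hLd hKd) hVd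
  have hKi := differentiableAt_matrix_inv hKd hK
  have hKri := differentiableAt_matrix_inv hKrd hKr
  obtain ⟨E, hE⟩ : ∃ E : ℂ → Matrix ι ι ℂ, ∀ z, E z = (K z)⁻¹ - V * (L * K z * V)⁻¹ * L :=
    ⟨_, fun _ => rfl⟩
  have hEd : ∀ i j, DifferentiableAt ℂ (fun z => E z i j) z₀ := fun i j => by
    simp only [hE, Matrix.sub_apply]
    exact (hKi i j).fun_sub (differentiableAt_matrix_mul
      (A := fun z => V * (L * K z * V)⁻¹) (A' := fun _ => L)
      (differentiableAt_matrix_mul (A := fun _ => V) hVd hKri) hLd i j)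
  have hred : DifferentiableAt ℂ
      (fun z => (x z ᵥ* V) ⬝ᵥ ((L * K z * V)⁻¹ *ᵥ (L *ᵥ y z))) z₀ :=
    differentiableAt_dotProduct (x := fun z => x z ᵥ* V)
      (differentiableAt_vecMul (A := fun _ => V) hVd hxd)
      (differentiableAt_mulVec (x := fun z => L *ᵥ y z) hKri
        (differentiableAt_mulVec (A := fun _ => L) hLd hyd))
  have hx0 : x z₀ ᵥ* E z₀ = 0 := by
    rw [hE, Matrix.vecMul_sub, ← Matrix.vecMul_vecMul, ← Matrix.vecMul_vecMul,
      petrovGalerkin_vecMul hK hKr hx, sub_self]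
  have hy0 : E z₀ *ᵥ y z₀ = 0 := by
    rw [hE, Matrix.sub_mulVec, ← Matrix.mulVec_mulVec, ← Matrix.mulVec_mulVec,
      petrovGalerkin_mulVec hK hKr hy, sub_self]
  have herr : HasDerivAt (fun z => (x z ᵥ* E z) ⬝ᵥ (K z *ᵥ (E z *ᵥ y z))) 0 z₀ :=
    hasDerivAt_dotProduct_of_eq_zero (x := fun z => x z ᵥ* E z)
      (y := fun z => K z *ᵥ (E z *ᵥ y z)) (differentiableAt_vecMul hEd hxd)
      (differentiableAt_mulVec (x := fun z => E z *ᵥ y z) hKd (differentiableAt_mulVec hEd hyd)) hx0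
      (by rw [hy0, Matrix.mulVec_zero])
  have hsum := hred.hasDerivAt.add herr
  rw [add_zero] at hsum
  refine (hsum.congr_of_eventuallyEq ?_).deriv
  filter_upwards [eventually_isUnit_det hKd hK, eventually_isUnit_det hKrd hKr] with z hz hzr
  have hz' : (x z ᵥ* E z) ⬝ᵥ (K z *ᵥ (E z *ᵥ y z)) = x z ⬝ᵥ (E z *ᵥ y z) := by
    rw [← Matrix.dotProduct_mulVec, Matrix.mulVec_mulVec, Matrix.mulVec_mulVec, hE,
      petrovGalerkin_error_mul hz hzr]
  rw [Pi.add_apply, hz', hE, Matrix.sub_mulVec, dotProduct_sub, ← Matrix.mulVec_mulVec,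
    ← Matrix.mulVec_mulVec, Matrix.dotProduct_mulVec _ V, add_sub_cancel]

end Projection

section Blocks

variable {n m p : ℕ} (K : ℂ → Matrix (Fin n) (Fin n) ℂ) (B : ℂ → Matrix (Fin n) (Fin m) ℂ)
  (N : Fin m → ℂ → Matrix (Fin n) (Fin n) ℂ)

lemma Zblk_mul_tangMat (s : ℕ → ℂ) (b : Fin m → ℂ) (j : ℕ) :
    Zblk K B N s j * tangMat b j = Vblk K B N s b j := by
  induction j with
  | zero =>
    ext i e
    simp only [Zblk, tangMat, Vblk, Matrix.mulVec_mulVec]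
    rfl
  | succ j ih =>
    change (K (s (j + 1)))⁻¹ * Nbig N (s j) * ((1 : Matrix (Fin m) (Fin m) ℂ) ⊗ₖ Zblk K B N s j) *
        ((1 : Matrix (Fin m) (Fin m) ℂ) ⊗ₖ tangMat b j) =
      (K (s (j + 1)))⁻¹ * Nbig N (s j) * ((1 : Matrix (Fin m) (Fin m) ℂ) ⊗ₖ Vblk K B N s b j)
    rw [Matrix.mul_assoc, ← Matrix.mul_kronecker_mul, Matrix.one_mul, ih]

lemma Vblk_zero_col (s : ℕ → ℂ) (b : Fin m → ℂ) (cc : outT m 0) :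
    (Vblk K B N s b 0).col cc = (K (s 0))⁻¹ *ᵥ (B (s 0) *ᵥ b) := rfl

lemma Vblk_succ_col (s : ℕ → ℂ) (b : Fin m → ℂ) (j : ℕ) (a : Fin m) (cc : outT m j) :
    (Vblk K B N s b (j + 1)).col (a, cc) =
      (K (s (j + 1)))⁻¹ *ᵥ (N a (s j) *ᵥ (Vblk K B N s b j).col cc) := by
  have h : (Nbig N (s j) * ((1 : Matrix (Fin m) (Fin m) ℂ) ⊗ₖ Vblk K B N s b j)).col (a, cc) =
      N a (s j) *ᵥ (Vblk K B N s b j).col cc := by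
    ext i
    simp [Matrix.mul_apply, Nbig, Fintype.sum_prod_type, Matrix.one_apply, Matrix.mulVec,
      dotProduct]
  rw [← h]
  ext i
  exact congrFun (congrFun (Matrix.mul_assoc (K (s (j + 1)))⁻¹ (Nbig N (s j))
    ((1 : Matrix (Fin m) (Fin m) ℂ) ⊗ₖ Vblk K B N s b j)) i) (a, cc)

lemma Vblk_update_of_lt (s : ℕ → ℂ) (b : Fin m → ℂ) {i j : ℕ} (hj : j < i) (z : ℂ) :
    Vblk K B N (Function.update s i z) b j = Vblk K B N s b j := by
  induction j with
  | zero => simp [Vblk, hj.ne]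
  | succ j ih =>
    rw [Vblk, Vblk, ih (Nat.lt_of_succ_lt hj), Function.update_of_ne hj.ne,
      Function.update_of_ne (Nat.lt_of_succ_lt hj).ne]

lemma star_Wblk_zero_col (C : ℂ → Matrix (Fin p) (Fin n) ℂ) (τ : ℕ → ℂ) (c : Fin p → ℂ)
    (cc : outT m 0) :
    star ((Wblk C K N τ c 0).col cc) = (star c ᵥ* C (τ 0)) ᵥ* (K (τ 0))⁻¹ := by
  have h : (Wblk C K N τ c 0).col cc = ((K (τ 0))⁻¹)ᴴ *ᵥ ((C (τ 0))ᴴ *ᵥ c) := rfl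
  rw [h, Matrix.star_mulVec, Matrix.star_mulVec, Matrix.conjTranspose_conjTranspose,
    Matrix.conjTranspose_conjTranspose]

lemma star_Wblk_succ_col (C : ℂ → Matrix (Fin p) (Fin n) ℂ) (τ : ℕ → ℂ) (c : Fin p → ℂ) (t : ℕ)
    (a : Fin m) (cc : outT m t) :
    star ((Wblk C K N τ c (t + 1)).col (a, cc)) =
      (star ((Wblk C K N τ c t).col cc) ᵥ* N a (τ (t + 1))) ᵥ* (K (τ (t + 1)))⁻¹ := by
  have h : ((Ntil N (τ (t + 1)))ᴴ *
      ((1 : Matrix (Fin m) (Fin m) ℂ) ⊗ₖ Wblk C K N τ c t)).col (a, cc) =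
      (N a (τ (t + 1)))ᴴ *ᵥ (Wblk C K N τ c t).col cc := by
    ext i
    simp [Matrix.mul_apply, Ntil, Fintype.sum_prod_type, Matrix.one_apply, Matrix.mulVec,
      dotProduct]
  have h' : (Wblk C K N τ c (t + 1)).col (a, cc) = ((K (τ (t + 1)))⁻¹)ᴴ *ᵥ
      ((N a (τ (t + 1)))ᴴ *ᵥ (Wblk C K N τ c t).col cc) := by
    rw [← h]
    ext i
    exact congrFun (congrFun (Matrix.mul_assoc ((K (τ (t + 1)))⁻¹)ᴴ (Ntil N (τ (t + 1)))ᴴ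
      ((1 : Matrix (Fin m) (Fin m) ℂ) ⊗ₖ Wblk C K N τ c t)) i) (a, cc)
  rw [h', Matrix.star_mulVec, Matrix.star_mulVec, Matrix.conjTranspose_conjTranspose,
    Matrix.conjTranspose_conjTranspose]

lemma vecMul_Gblk_mul_tangMat (C : ℂ → Matrix (Fin p) (Fin n) ℂ) (s : ℕ → ℂ) (b : Fin m → ℂ)
    (c : Fin p → ℂ) (q : ℕ) (cc : outT m q) :
    (star c ᵥ* (Gblk C K B N s q * tangMat b q)) cc =
      (star c ᵥ* C (s q)) ⬝ᵥ (Vblk K B N s b q).col cc := by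
  rw [Gblk, Matrix.mul_assoc, Zblk_mul_tangMat, ← Matrix.vecMul_vecMul]
  rfl

variable {r : ℕ} {K B N}

lemma mulVec_Vblk_reduced_col {V : Matrix (Fin n) (Fin r) ℂ} {L : Matrix (Fin r) (Fin n) ℂ}
    {σ : ℕ → ℂ} {b : Fin m → ℂ} {q : ℕ}
    (hK : ∀ j ≤ q, IsUnit (K (σ j)).det) (hKr : ∀ j ≤ q, IsUnit (L * K (σ j) * V).det)
    (hV : ∀ j ≤ q, ∀ cc : outT m j, (Vblk K B N σ b j).col cc ∈ Set.range V.mulVec)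
    {j : ℕ} (hj : j ≤ q) (cc : outT m j) :
    V *ᵥ (Vblk (fun s => L * K s * V) (fun s => L * B s) (fun a s => L * N a s * V) σ b j).col cc =
      (Vblk K B N σ b j).col cc := by
  induction j with
  | zero =>
    have h := hV 0 hj cc
    rw [Vblk_zero_col] at h ⊢
    rw [Vblk_zero_col, ← Matrix.mulVec_mulVec, petrovGalerkin_mulVec (hK 0 hj) (hKr 0 hj) h]
  | succ j ih =>
    obtain ⟨a, cc⟩ := cc
    have h := hV (j + 1) hj (a, cc)
    rw [Vblk_succ_col] at h ⊢
    rw [Vblk_succ_col, ← Matrix.mulVec_mulVec, ih (Nat.le_of_succ_le hj),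
      ← Matrix.mulVec_mulVec, petrovGalerkin_mulVec (hK _ hj) (hKr _ hj) h]

/-- Matching of first partial derivatives of the chain `Vblk` contracted with a row function
whose interpolation data lie in the row space of `L`. -/
lemma pD_dotProduct_Vblk_reduced {C : ℂ → Matrix (Fin p) (Fin n) ℂ}
    {V : Matrix (Fin n) (Fin r) ℂ} {L : Matrix (Fin r) (Fin n) ℂ}
    {σ τ : ℕ → ℂ} {b : Fin m → ℂ} {c : Fin p → ℂ} {q : ℕ}
    (hKd : ∀ j ≤ q, ∀ a e, DifferentiableAt ℂ (fun z => K z a e) (σ j))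
    (hBd : ∀ j ≤ q, ∀ a e, DifferentiableAt ℂ (fun z => B z a e) (σ j))
    (hNd : ∀ j ≤ q, ∀ l a e, DifferentiableAt ℂ (fun z => N l z a e) (σ j))
    (hK : ∀ j ≤ q, IsUnit (K (σ j)).det) (hKr : ∀ j ≤ q, IsUnit (L * K (σ j) * V).det)
    (hV : ∀ j ≤ q, ∀ cc : outT m j, (Vblk K B N σ b j).col cc ∈ Set.range V.mulVec)
    (hτ : ∀ j t, j + t = q → τ t = σ j)
    (hL : ∀ t ≤ q, ∀ cc : outT m t, ∃ g, star ((Wblk C K N τ c t).col cc) = g ᵥ* L)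
    {j t : ℕ} (hjt : j + t = q) (cc : outT m j) (cw : outT m t) {x : ℂ → Fin n → ℂ}
    (hxd : ∀ i, DifferentiableAt ℂ (fun z => x z i) (σ j))
    (hx : x (σ j) ᵥ* (K (σ j))⁻¹ = star ((Wblk C K N τ c t).col cw)) {i : ℕ} (hi : i ≤ j) :
    pD i (fun s => x (s j) ⬝ᵥ (Vblk K B N s b j).col cc) σ =
      pD i (fun s => (x (s j) ᵥ* V) ⬝ᵥ
        (Vblk (fun s => L * K s * V) (fun s => L * B s) (fun a s => L * N a s * V) s b j).col cc)
        σ := by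
  have hxL : ∃ g, x (σ j) ᵥ* (K (σ j))⁻¹ = g ᵥ* L := hx ▸ hL t (by omega) cw
  have hjq : j ≤ q := by omega
  induction j generalizing t x with
  | zero =>
    obtain rfl : i = 0 := by omega
    simp only [pD, Vblk_zero_col, Function.update_self, ← Matrix.mulVec_mulVec]
    have h := hV 0 hjq cc
    rw [Vblk_zero_col] at h
    exact deriv_petrovGalerkin (hKd 0 hjq) hxd
      (differentiableAt_mulVec (hBd 0 hjq) fun _ => differentiableAt_const _)
      (hK 0 hjq) (hKr 0 hjq) hxL h
  | succ j ih =>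
    obtain ⟨a, cc⟩ := cc
    have hjq' : j ≤ q := by omega
    rcases hi.eq_or_lt with rfl | hlt
    · have hne : j ≠ j + 1 := by omega
      simp only [pD, Vblk_succ_col, Function.update_self, Function.update_of_ne hne,
        Vblk_update_of_lt _ _ _ _ _ (Nat.lt_succ_self j), ← Matrix.mulVec_mulVec,
        mulVec_Vblk_reduced_col hK hKr hV hjq']
      have h := hV (j + 1) hjq (a, cc)
      rw [Vblk_succ_col] at h
      exact deriv_petrovGalerkin (y := fun _ => N a (σ j) *ᵥ (Vblk K B N σ b j).col cc)
        (hKd _ hjq) hxd (fun _ => differentiableAt_const _) (hK _ hjq) (hKr _ hjq) hxL h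
    · have hij : i ≤ j := by omega
      have hjt' : j + (t + 1) = q := by omega
      have hx' : ((x (σ (j + 1)) ᵥ* (K (σ (j + 1)))⁻¹) ᵥ* N a (σ j)) ᵥ* (K (σ j))⁻¹ =
          star ((Wblk C K N τ c (t + 1)).col (a, cw)) := by
        rw [star_Wblk_succ_col, hτ j (t + 1) hjt', hx]
      have key := ih (x := fun z => (x (σ (j + 1)) ᵥ* (K (σ (j + 1)))⁻¹) ᵥ* N a z) hjt' cc (a, cw)
        (differentiableAt_vecMul (hNd j hjq' a) fun _ => differentiableAt_const _) hx' hij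
        ((hL (t + 1) (by omega) (a, cw)).imp fun _ hg => hx'.trans hg) hjq'
      have hne : j + 1 ≠ i := by omega
      simp only [pD, Vblk_succ_col, Function.update_of_ne hne, Matrix.dotProduct_mulVec,
        ← Matrix.vecMul_vecMul, petrovGalerkin_vecMul (hK _ hjq) (hKr _ hjq) hxL]
      exact key

end Blocks

theorem stmt_14 {n m p r : ℕ} (hn : 0 < n) (hm : 0 < m) (hp : 0 < p) (hr : 0 < r)
    (C : ℂ → Matrix (Fin p) (Fin n) ℂ) (K : ℂ → Matrix (Fin n) (Fin n) ℂ)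
    (B : ℂ → Matrix (Fin n) (Fin m) ℂ) (N : Fin m → ℂ → Matrix (Fin n) (Fin n) ℂ)
    (V W : Matrix (Fin n) (Fin r) ℂ)
    (k : ℕ) (hk : 0 < k) (σ : ℕ → ℂ) (b : Fin m → ℂ) (c : Fin p → ℂ)
    (hCa : ∀ j < k, ∀ a e, AnalyticAt ℂ (fun z => C z a e) (σ j))
    (hKa : ∀ j < k, ∀ a e, AnalyticAt ℂ (fun z => K z a e) (σ j))
    (hBa : ∀ j < k, ∀ a e, AnalyticAt ℂ (fun z => B z a e) (σ j))
    (hNa : ∀ j < k, ∀ ι a e, AnalyticAt ℂ (fun z => N ι z a e) (σ j))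
    (hK : ∀ j < k, IsUnit (K (σ j)).det)
    (hKr : ∀ j < k, IsUnit (Wᴴ * K (σ j) * V).det)
    (hV : ∀ j < k, ∀ cix : outT m j,
      (fun i => Vblk K B N σ b j i cix) ∈ Set.range V.mulVec)
    (hW : ∀ t < k, ∀ cix : outT m t,
      (fun i => Wblk C K N (fun t => σ (k - 1 - t)) c t i cix) ∈ Set.range W.mulVec) :
    ∀ i < k, ∀ cc : outT m (k - 1),
      pD i (fun s =>
          Matrix.vecMul (star c) (Gblk C K B N s (k - 1) * tangMat b (k - 1)) cc) σ =
        pD i (fun s =>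
          Matrix.vecMul (star c)
            (Gblk (fun s => C s * V) (fun s => Wᴴ * K s * V) (fun s => Wᴴ * B s) (fun ι s => Wᴴ * N ι s * V) s (k - 1) * tangMat b (k - 1)) cc) σ := by
  obtain ⟨q, rfl⟩ : ∃ q, k = q + 1 := ⟨k - 1, by omega⟩
  intro i hi (cc : outT m q)
  simp only [Nat.add_sub_cancel, vecMul_Gblk_mul_tangMat, ← Matrix.vecMul_vecMul] at hW ⊢
  have hlt : ∀ {j}, j ≤ q → j < q + 1 := Nat.lt_succ_of_le
  refine pD_dotProduct_Vblk_reduced (C := C) (τ := fun t => σ (q - t)) (c := c) (t := 0)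
    (fun j hj a e => (hKa j (hlt hj) a e).differentiableAt)
    (fun j hj a e => (hBa j (hlt hj) a e).differentiableAt)
    (fun j hj l a e => (hNa j (hlt hj) l a e).differentiableAt)
    (fun j hj => hK j (hlt hj)) (fun j hj => hKr j (hlt hj)) (fun j hj => hV j (hlt hj))
    (fun j t h => congrArg σ (by omega)) (fun t ht cw => ?_) (add_zero q) cc (0 : Fin 1)
    (x := fun z => star c ᵥ* C z)
    (differentiableAt_vecMul (fun a e => (hCa q (hlt le_rfl) a e).differentiableAt)
      fun _ => differentiableAt_const _)
    (star_Wblk_zero_col K N C (fun t => σ (q - t)) c _).symm (Nat.le_of_lt_succ hi)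
  obtain ⟨g, hg⟩ := hW t (hlt ht) cw
  exact ⟨star g, by rw [← Matrix.star_mulVec]; exact congrArg star hg.symm⟩

end StructBilin
end

section
/- Let k ≥ 1, let s_1,…,s_k ∈ ℂ be points at which K is invertible, and let d^{(1)},…,d^{(k-1)} ∈ ℂ^m. Then G_k(s_1,…,s_k) (d^{(k-1)} ⊗ d^{(k-2)} ⊗ ⋯ ⊗ d^{(1)} ⊗ I_m) = 𝔾_k(s_1,…,s_k | d^{(1)},…,d^{(k-1)}); that is, multiplying the k-th subsystem transfer function on the right by the Kronecker product of the scaling vectors (with the identity in the last factor) collapses each concatenated bilinear block to the scaled sum 𝔑(s_j, d^{(j)}) = Σ_{i=1}^m d^{(j)}_i N_i(s_j) and yields the modified transfer function. -/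
open Matrix
open scoped Kronecker

namespace StructBilin

/-- Multiplying `N(s) (I_m ⊗ Z)` by the Kronecker product `δ ⊗ D` collapses the concatenated
bilinear block to the scaled sum `𝔑(s, δ)`. -/
theorem Nbig_mul_one_kronecker_mul {n m : ℕ} {α β : Type*} [Fintype α]
    (N : Fin m → ℂ → Matrix (Fin n) (Fin n) ℂ) (s : ℂ) (δ : Fin m → ℂ)
    (Z : Matrix (Fin n) α ℂ) (D : Matrix α β ℂ) :
    Nbig N s * ((1 : Matrix (Fin m) (Fin m) ℂ) ⊗ₖ Z) *
        (Matrix.of fun (q : Fin m × α) c => δ q.1 * D q.2 c) =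
      Nsum N s δ * (Z * D) := by
  have hZ : ((1 : Matrix (Fin m) (Fin m) ℂ) ⊗ₖ Z) *
      (Matrix.of fun (q : Fin m × α) c => δ q.1 * D q.2 c) =
        Matrix.of fun (q : Fin m × Fin n) c => δ q.1 * (Z * D) q.2 c := by
    ext ⟨i, x⟩ c
    simp [Matrix.mul_apply, Fintype.sum_prod_type, Matrix.one_apply, Finset.mul_sum,
      mul_left_comm]
  rw [Matrix.mul_assoc, hZ]
  ext x c
  simp only [Nbig, Nsum, Matrix.sum_mul, Matrix.sum_apply, Matrix.smul_mul, Matrix.smul_apply,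
    Matrix.mul_apply (M := N _ s), Matrix.mul_apply (M := Matrix.of _), Matrix.of_apply,
    Fintype.sum_prod_type, smul_eq_mul, Finset.mul_sum, mul_left_comm]

theorem Zblk_mul_dKron {n m : ℕ} (K : ℂ → Matrix (Fin n) (Fin n) ℂ)
    (B : ℂ → Matrix (Fin n) (Fin m) ℂ) (N : Fin m → ℂ → Matrix (Fin n) (Fin n) ℂ)
    (σ : ℕ → ℂ) (d : ℕ → Fin m → ℂ) (j : ℕ) :
    Zblk K B N σ j * dKron d j = gAux K B N σ d j := by
  induction j with
  | zero => exact Matrix.mul_one ((K (σ 0))⁻¹ * B (σ 0))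
  | succ j ih =>
    have h := Nbig_mul_one_kronecker_mul N (σ j) (d j) (Zblk K B N σ j) (dKron d j)
    rw [ih] at h
    change (K (σ (j + 1)))⁻¹ * Nbig N (σ j) *
        ((1 : Matrix (Fin m) (Fin m) ℂ) ⊗ₖ Zblk K B N σ j) *
        (Matrix.of fun (q : Fin m × colT m j) c => d j q.1 * dKron d j q.2 c) =
      (K (σ (j + 1)))⁻¹ * Nsum N (σ j) (d j) * gAux K B N σ d j
    rw [Matrix.mul_assoc, Matrix.mul_assoc, ← Matrix.mul_assoc (Nbig N (σ j)), h,
      Matrix.mul_assoc]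

theorem stmt_16 {n m p : ℕ} (hn : 0 < n) (hm : 0 < m) (hp : 0 < p)
    (C : ℂ → Matrix (Fin p) (Fin n) ℂ) (K : ℂ → Matrix (Fin n) (Fin n) ℂ)
    (B : ℂ → Matrix (Fin n) (Fin m) ℂ) (N : Fin m → ℂ → Matrix (Fin n) (Fin n) ℂ)
    (k : ℕ) (hk : 0 < k) (σ : ℕ → ℂ) (d : ℕ → Fin m → ℂ)
    (hK : ∀ j < k, IsUnit (K (σ j)).det) :
    Gblk C K B N σ (k - 1) * dKron d (k - 1) = Gmod C K B N σ d (k - 1) := by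
  rw [Gblk, Gmod, Matrix.mul_assoc, Zblk_mul_dKron]

end StructBilin
end
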